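/- arXiv:gr-qc/0410061 — 4 statements merged into one kernel-verified Lean document; each statement's English description precedes it below -/
import Mathlib

section
/- Future asymptotics of generic scalar-field modes on the LRS vacuum Bianchi VIII (NUT) solution: let l > 0, μ ∈ ℝ, m a nonzero integer, and Λ ≥ 0. Define f(t) = t² − l² + 2μt and Z_m(t) = (m²/(4l²))·((t²+l²)/f(t))² + (m²+Λ)/f(t). Then for each sign ε ∈ {+1,−1} there exist t₀ ∈ ℝ with f > 0 on (t₀,∞) and a twice differentiable function ψ : (t₀,∞) → ℂ satisfying ψ''(t) + (f'(t)/f(t))·ψ'(t) + Z_m(t)·ψ(t) = 0 for all t > t₀ and lim_{t→∞} ψ(t) · t · exp(−ε·i·(|m|/(2l))·(t − 2μ·log t)) = 1; i.e. the equation has fundamental solutions t^{−1} e^{±i|m/(2l)|(t − 2μ log t)}(1 + o(1)). -/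
noncomputable section

open Set Filter

open MeasureTheory Topology

/-- A linear ODE whose coefficient is integrable near `+∞` has a solution with any prescribed
limit at `+∞`. -/
theorem exists_hasDerivAt_clm_tendsto_atTop {E : Type*} [NormedAddCommGroup E] [NormedSpace ℝ E]
    [CompleteSpace E] {M : ℝ → E →L[ℝ] E} {T₀ : ℝ} (hc : ContinuousOn M (Ioi T₀))
    (hi : IntegrableOn M (Ioi T₀)) (v : E) :
    ∃ T ≥ T₀, ∃ Y : ℝ → E,
      (∀ t ∈ Ioi T, HasDerivAt Y (M t (Y t)) t) ∧ Tendsto Y atTop (𝓝 v) := by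
  obtain ⟨T, hT, hT₀⟩ : ∃ T, ∫ t in Ioi T, ‖M t‖ < 1 ∧ T₀ ≤ T :=
    (((tendsto_integral_Ioi_zero (f := fun t => ‖M t‖) (μ := volume)
      tendsto_id).eventually_lt_const one_pos).and (eventually_ge_atTop T₀)).exists
  have hiT : IntegrableOn M (Ioi T) := hi.mono_set (Ioi_subset_Ioi hT₀)
  set N : ℝ → E →L[ℝ] E := (Ioi T).indicator M with hN
  have hNi : Integrable N := by
    have := (integrable_indicator_iff (f := M) (μ := volume) measurableSet_Ioi).2 hiT
    exact this
  have hN_norm : ∫ t, ‖N t‖ < 1 := by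
    simpa only [hN, norm_indicator_eq_indicator_norm, integral_indicator measurableSet_Ioi] using hT
  have hNY (Y : BoundedContinuousFunction ℝ E) : Integrable fun t => N t (Y t) := by
    refine (hNi.norm.mul_const ‖Y‖).mono' ?_ (.of_forall fun t => ?_)
    · exact (ContinuousLinearMap.id ℝ (E →L[ℝ] E)).aestronglyMeasurable_comp₂
        hNi.aestronglyMeasurable Y.continuous.aestronglyMeasurable
    · exact (N t).le_opNorm_of_le (Y.norm_coe_le_norm t)
  have hbound (Y : BoundedContinuousFunction ℝ E) (t : ℝ) :
      ‖∫ s in Ioi t, N s (Y s)‖ ≤ (∫ s, ‖N s‖) * ‖Y‖ := by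
    rw [← integral_mul_const]
    refine (norm_integral_le_of_norm_le (hNi.norm.mul_const ‖Y‖).integrableOn
      (.of_forall fun s => (N s).le_opNorm_of_le (Y.norm_coe_le_norm s))).trans ?_
    exact setIntegral_le_integral (hNi.norm.mul_const ‖Y‖) (.of_forall fun s => by positivity)
  have htail (Y : BoundedContinuousFunction ℝ E) (t : ℝ) :
      ∫ s in Ioi t, N s (Y s) =
        (∫ s in Ioi T, N s (Y s)) - ∫ s in T..t, N s (Y s) := by
    rw [← intervalIntegral.integral_Ioi_sub_Ioi' (hNY Y).integrableOn (hNY Y).integrableOn]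
    abel
  have hcont (Y : BoundedContinuousFunction ℝ E) :
      Continuous fun t => v - ∫ s in Ioi t, N s (Y s) := by
    have : (fun t => v - ∫ s in Ioi t, N s (Y s)) =
        fun t => v - ((∫ s in Ioi T, N s (Y s)) - ∫ s in T..t, N s (Y s)) :=
      funext fun t => by rw [htail Y t]
    rw [this]
    exact continuous_const.sub (continuous_const.sub ((hNY Y).continuous_primitive T))
  let F (Y : BoundedContinuousFunction ℝ E) : BoundedContinuousFunction ℝ E :=
    .ofNormedAddCommGroup (fun t => v - ∫ s in Ioi t, N s (Y s)) (hcont Y)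
      (‖v‖ + (∫ s, ‖N s‖) * ‖Y‖)
      fun t => (norm_sub_le _ _).trans (add_le_add_right (hbound Y t) _)
  have hK : 0 ≤ ∫ s, ‖N s‖ := integral_nonneg fun s => norm_nonneg _
  have hF : ContractingWith ⟨∫ s, ‖N s‖, hK⟩ F := by
    refine ⟨hN_norm, LipschitzWith.of_dist_le_mul fun Y Y' => ?_⟩
    refine (BoundedContinuousFunction.dist_le (by positivity)).2 fun t => ?_
    have : F Y t - F Y' t = -∫ s in Ioi t, N s ((Y - Y') s) := by
      have : ∫ s in Ioi t, N s ((Y - Y') s) =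
          (∫ s in Ioi t, N s (Y s)) - ∫ s in Ioi t, N s (Y' s) := by
        rw [← integral_sub (hNY Y).integrableOn (hNY Y').integrableOn]
        simp only [BoundedContinuousFunction.coe_sub, Pi.sub_apply, map_sub]
      rw [this]
      change (v - _) - (v - _) = _
      abel
    rw [dist_eq_norm, this, norm_neg, dist_eq_norm]
    exact hbound _ t
  set Y := hF.fixedPoint with hY
  have hfix (t : ℝ) : Y t = v - ∫ s in Ioi t, N s (Y s) :=
    congrArg (fun Z : BoundedContinuousFunction ℝ E => Z t) hF.fixedPoint_isFixedPt.symm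
  refine ⟨T, hT₀, Y, fun t ht => ?_, ?_⟩
  · have hNt : N =ᶠ[𝓝 t] M := by
      filter_upwards [Ioi_mem_nhds ht] with s hs using indicator_of_mem hs M
    have hcM : ContinuousAt N t :=
      (hc.continuousAt (Ioi_mem_nhds (hT₀.trans_lt ht))).congr hNt.symm
    have hd := intervalIntegral.integral_hasDerivAt_right (a := T) (b := t)
      (hNY Y).intervalIntegrable ((hNY Y).aestronglyMeasurable.stronglyMeasurableAtFilter)
      (hcM.clm_apply Y.continuous.continuousAt)
    rw [hNt.self_of_nhds] at hd
    have : (Y : ℝ → E) = fun t => (v - ∫ s in Ioi T, N s (Y s)) + ∫ s in T..t, N s (Y s) := by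
      funext t
      rw [hfix, htail]
      abel
    rw [this]
    simp only [← congrFun this t]
    exact hd.const_add _
  · have : (Y : ℝ → E) = fun t => v - ∫ s in Ioi t, N s (Y s) := funext hfix
    rw [this]
    simpa using (tendsto_integral_Ioi_zero (f := fun s => N s (Y s)) (μ := volume)
      tendsto_id).const_sub v

/-- An integrable perturbation of the oscillator `S' = iωD`, `D' = iωS` has a solution asymptotic
to the unperturbed one `S = D = exp (iθ)`, where `θ' = ω`. -/
theorem exists_perturbed_oscillator_tendsto {T₀ : ℝ} {θ ω ρ : ℝ → ℝ}
    (hθ : ∀ t ∈ Ioi T₀, HasDerivAt θ (ω t) t) (hc : ContinuousOn ρ (Ioi T₀))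
    (hi : IntegrableOn ρ (Ioi T₀)) :
    ∃ T ≥ T₀, ∃ S D : ℝ → ℂ,
      (∀ t ∈ Ioi T, HasDerivAt S (Complex.I * ω t * D t) t ∧
        HasDerivAt D (Complex.I * (ω t + ρ t) * S t) t) ∧
      Tendsto (fun t => S t * Complex.exp (-(Complex.I * θ t))) atTop (𝓝 1) := by
  let A : ℂ × ℂ →L[ℝ] ℂ × ℂ :=
    (ContinuousLinearMap.fst ℝ ℂ ℂ).prod (-ContinuousLinearMap.snd ℝ ℂ ℂ)
  let B : ℂ × ℂ →L[ℝ] ℂ × ℂ := (ContinuousLinearMap.snd ℝ ℂ ℂ).prod 0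
  let C : ℂ × ℂ →L[ℝ] ℂ × ℂ := (0 : ℂ × ℂ →L[ℝ] ℂ).prod (ContinuousLinearMap.fst ℝ ℂ ℂ)
  let p (t : ℝ) : ℂ := Complex.exp (Complex.I * θ t)
  let n (t : ℝ) : ℂ := Complex.exp (-(Complex.I * θ t))
  let L (t : ℝ) : ℂ × ℂ →L[ℝ] ℂ × ℂ :=
    (Complex.I / 2) • (A + (n t ^ 2) • B - (p t ^ 2) • C)
  let M (t : ℝ) : ℂ × ℂ →L[ℝ] ℂ × ℂ := ρ t • L t
  have hpn (t : ℝ) : p t * n t = 1 := by simp [p, n, ← Complex.exp_add]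
  have hp_norm (t : ℝ) : ‖p t‖ = 1 := by
    simpa only [p, mul_comm Complex.I] using Complex.norm_exp_ofReal_mul_I (θ t)
  have hn_norm (t : ℝ) : ‖n t‖ = 1 := by
    simpa [hp_norm] using congrArg norm (hpn t)
  have hθc : ContinuousOn θ (Ioi T₀) := fun t ht => (hθ t ht).continuousAt.continuousWithinAt
  have hLc : ContinuousOn L (Ioi T₀) := by fun_prop
  have hMc : ContinuousOn M (Ioi T₀) := hc.smul hLc
  have hLb (t : ℝ) : ‖L t‖ ≤ 1 / 2 * (‖A‖ + ‖B‖ + ‖C‖) := by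
    refine (norm_smul_le (Complex.I / 2) (A + (n t ^ 2) • B - (p t ^ 2) • C)).trans ?_
    have h1 : ‖(n t ^ 2) • B‖ ≤ ‖B‖ := by rw [norm_smul, norm_pow, hn_norm, one_pow, one_mul]
    have h2 : ‖(p t ^ 2) • C‖ ≤ ‖C‖ := by rw [norm_smul, norm_pow, hp_norm, one_pow, one_mul]
    have h3 := norm_sub_le (A + (n t ^ 2) • B) ((p t ^ 2) • C)
    have h4 := norm_add_le A ((n t ^ 2) • B)
    rw [show ‖Complex.I / 2‖ = 1 / 2 by simp]
    gcongr
    linarith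
  have hMi : IntegrableOn M (Ioi T₀) :=
    Integrable.smul_bdd hi (1 / 2 * (‖A‖ + ‖B‖ + ‖C‖))
      (hLc.aestronglyMeasurable measurableSet_Ioi) (.of_forall hLb)
  obtain ⟨T, hT, Y, hY, hlim⟩ := exists_hasDerivAt_clm_tendsto_atTop hMc hMi (1, 0)
  refine ⟨T, hT, fun t => (Y t).1 * p t + (Y t).2 * n t, fun t => (Y t).1 * p t - (Y t).2 * n t,
    fun t ht => ?_, ?_⟩
  · have h1 : HasDerivAt (fun t => (Y t).1)
        (ρ t * (Complex.I / 2) * ((Y t).1 + n t ^ 2 * (Y t).2)) t := by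
      have := (ContinuousLinearMap.fst ℝ ℂ ℂ).hasFDerivAt.comp_hasDerivAt t (hY t ht)
      simpa [M, L, A, B, C, Function.comp_def, mul_assoc] using this
    have h2 : HasDerivAt (fun t => (Y t).2)
        (ρ t * (Complex.I / 2) * (-(Y t).2 - p t ^ 2 * (Y t).1)) t := by
      have := (ContinuousLinearMap.snd ℝ ℂ ℂ).hasFDerivAt.comp_hasDerivAt t (hY t ht)
      simpa [M, L, A, B, C, Function.comp_def, mul_assoc] using this
    have hphase : HasDerivAt (fun t => Complex.I * (θ t : ℂ)) (Complex.I * ω t) t :=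
      ((hθ t (hT.trans_lt ht)).ofReal_comp).const_mul _
    have hp : HasDerivAt p (p t * (Complex.I * ω t)) t := hphase.cexp
    have hn : HasDerivAt n (n t * -(Complex.I * ω t)) t := hphase.neg.cexp
    have e := hpn t
    constructor
    · refine ((h1.mul hp).add (h2.mul hn)).congr_deriv ?_
      linear_combination (ρ t * (Complex.I / 2) * n t * (Y t).2
        - ρ t * (Complex.I / 2) * p t * (Y t).1) * e
    · refine ((h1.mul hp).sub (h2.mul hn)).congr_deriv ?_
      linear_combination (ρ t * (Complex.I / 2) * n t * (Y t).2
        + ρ t * (Complex.I / 2) * p t * (Y t).1) * e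
  · have h1 : Tendsto (fun t => (Y t).1) atTop (𝓝 1) := (continuous_fst.tendsto _).comp hlim
    have h2 : Tendsto (fun t => (Y t).2 * n t ^ 2) atTop (𝓝 0) := by
      have h : Tendsto (fun t => (Y t).2) atTop (𝓝 0) := (continuous_snd.tendsto _).comp hlim
      exact squeeze_zero_norm (fun t => by simp [hn_norm]) (tendsto_zero_iff_norm_tendsto_zero.1 h)
    have := h1.add h2
    rw [add_zero] at this
    refine this.congr fun t => ?_
    change _ = ((Y t).1 * p t + (Y t).2 * n t) * n t
    linear_combination (-(Y t).1) * hpn t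

/-- The exact phase `∫ (t² + l²)/(t² - l² + 2μt) dt` differs from `t - 2μ log t` by `o(1)`, for a
suitable constant of integration. -/
theorem exists_hasDerivAt_nut_phase {l : ℝ} (hl : 0 < l) (μ : ℝ) :
    ∃ T ≥ 1, ∃ φ : ℝ → ℝ,
      (∀ t ∈ Ioi T, 0 < t ^ 2 - l ^ 2 + 2 * μ * t ∧
        HasDerivAt φ ((t ^ 2 + l ^ 2) / (t ^ 2 - l ^ 2 + 2 * μ * t)) t) ∧
      Tendsto (fun t => φ t - (t - 2 * μ * Real.log t)) atTop (𝓝 0) := by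
  obtain ⟨δ, hδ, hδ2⟩ : ∃ δ, 0 < δ ∧ δ ^ 2 = μ ^ 2 + l ^ 2 :=
    ⟨√(μ ^ 2 + l ^ 2), by positivity, Real.sq_sqrt (by positivity)⟩
  set A := (l ^ 2 - μ * (-μ + δ)) / δ with hA
  set B := -(l ^ 2 - μ * (-μ - δ)) / δ with hB
  have hAB : A + B = -2 * μ := by
    rw [hA, hB]
    field_simp
    ring
  refine ⟨max 1 (-μ + δ), le_max_left _ _,
    fun t => t + (A * Real.log (t + (μ - δ)) + B * Real.log (t + (μ + δ))), fun t ht => ?_, ?_⟩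
  · have h1 : 0 < t + (μ - δ) := by linarith [(max_lt_iff.1 (mem_Ioi.1 ht)).2]
    have h2 : 0 < t + (μ + δ) := by linarith
    have hfac : t ^ 2 - l ^ 2 + 2 * μ * t = (t + (μ - δ)) * (t + (μ + δ)) := by
      linear_combination hδ2
    refine ⟨hfac ▸ mul_pos h1 h2, ?_⟩
    have hd1 := (((hasDerivAt_id t).add_const (μ - δ)).log h1.ne').const_mul A
    have hd2 := (((hasDerivAt_id t).add_const (μ + δ)).log h2.ne').const_mul B
    refine ((hasDerivAt_id t).add (hd1.add hd2)).congr_deriv ?_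
    rw [hfac, eq_div_iff (mul_pos h1 h2).ne']
    simp only [id]
    have e : (1 + (A * (1 / (t + (μ - δ))) + B * (1 / (t + (μ + δ))))) *
        ((t + (μ - δ)) * (t + (μ + δ))) =
        (t + (μ - δ)) * (t + (μ + δ)) + A * (t + (μ + δ)) + B * (t + (μ - δ)) := by
      field_simp
      ring
    have eA : A * δ = l ^ 2 - μ * (-μ + δ) := div_mul_cancel₀ _ hδ.ne'
    have eB : B * δ = -(l ^ 2 - μ * (-μ - δ)) := div_mul_cancel₀ _ hδ.ne'
    rw [e]
    linear_combination (t + μ) * hAB + eA - eB - hδ2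
  · have h1 := (Real.tendsto_log_comp_add_sub_log (μ - δ)).const_mul A
    have h2 := (Real.tendsto_log_comp_add_sub_log (μ + δ)).const_mul B
    have := h1.add h2
    simp only [mul_zero, add_zero] at this
    refine this.congr fun t => ?_
    linear_combination (-Real.log t) * hAB

theorem integrableOn_inv_sq_add_sq (l : ℝ) :
    IntegrableOn (fun t : ℝ => (t ^ 2 + l ^ 2)⁻¹) (Ioi 1) := by
  refine Integrable.mono' (integrableOn_Ioi_rpow_of_lt (a := -2) (by norm_num) one_pos)
    (by fun_prop) ?_
  filter_upwards [ae_restrict_mem measurableSet_Ioi] with t ht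
  have ht0 : 0 < t := one_pos.trans ht
  rw [Real.norm_of_nonneg (by positivity), Real.rpow_neg ht0.le, Real.rpow_two]
  gcongr
  nlinarith [sq_nonneg l]

/-- The Liouville–Green error term of the mode equation, multiplied by `t² - l² + 2μt`, is
bounded. -/
theorem abs_nut_error_le (l μ c : ℝ) {t : ℝ} (ht : 1 < t) :
    |(2 * t ^ 2 - l ^ 2) * (t ^ 2 - l ^ 2 + 2 * μ * t) / (t ^ 2 + l ^ 2) ^ 2 -
      (2 * t + 2 * μ) * t / (t ^ 2 + l ^ 2) + c| ≤
      2 * (1 + 2 * |μ|) + (2 + 2 * |μ|) + |c| := by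
  have ht0 : 0 < t := one_pos.trans ht
  have hg : 0 < t ^ 2 + l ^ 2 := by positivity
  have hμ : |μ * t| ≤ |μ| * (t ^ 2 + l ^ 2) := by
    rw [abs_mul, abs_of_pos ht0]
    gcongr
    nlinarith [sq_nonneg l]
  have hμ' := abs_le.1 hμ
  have h1 : |2 * t ^ 2 - l ^ 2| ≤ 2 * (t ^ 2 + l ^ 2) :=
    abs_le.2 ⟨by nlinarith [sq_nonneg l, sq_nonneg t], by nlinarith [sq_nonneg l]⟩
  have h2 : |t ^ 2 - l ^ 2 + 2 * μ * t| ≤ (1 + 2 * |μ|) * (t ^ 2 + l ^ 2) :=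
    abs_le.2 ⟨by nlinarith [sq_nonneg l, sq_nonneg t], by nlinarith [sq_nonneg l]⟩
  have h3 : |(2 * t + 2 * μ) * t| ≤ (2 + 2 * |μ|) * (t ^ 2 + l ^ 2) :=
    abs_le.2 ⟨by nlinarith [sq_nonneg l, sq_nonneg t], by nlinarith [sq_nonneg l]⟩
  refine (abs_add_le _ _).trans (add_le_add_left ((abs_sub _ _).trans (add_le_add ?_ ?_)) _)
  · rw [abs_div, abs_of_pos (pow_pos hg 2), div_le_iff₀ (pow_pos hg 2), abs_mul]
    calc _ ≤ 2 * (t ^ 2 + l ^ 2) * ((1 + 2 * |μ|) * (t ^ 2 + l ^ 2)) := by gcongr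
      _ = _ := by ring
  · rwa [abs_div, abs_of_pos hg, div_le_iff₀ hg]

theorem tendsto_mul_inv_sqrt_sq_add_sq (l : ℝ) :
    Tendsto (fun t : ℝ => t * (√(t ^ 2 + l ^ 2))⁻¹) atTop (𝓝 1) := by
  have h : Tendsto (fun t : ℝ => (√(1 + (l / t) ^ 2))⁻¹) atTop (𝓝 1) := by
    have h0 : Tendsto (fun t : ℝ => l / t) atTop (𝓝 0) := tendsto_const_nhds.div_atTop tendsto_id
    simpa using (((h0.pow 2).const_add 1).sqrt).inv₀ (by simp)
  refine h.congr' ?_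
  filter_upwards [eventually_gt_atTop 0] with t ht
  have : t ^ 2 + l ^ 2 = t ^ 2 * (1 + (l / t) ^ 2) := by field_simp
  rw [this, Real.sqrt_mul (sq_nonneg t), Real.sqrt_sq ht.le, mul_inv, mul_inv_cancel_left₀ ht.ne']

theorem hasDerivAt_inv_sqrt_sq_add_sq {l : ℝ} (hl : 0 < l) (t : ℝ) :
    HasDerivAt (fun t : ℝ => (√(t ^ 2 + l ^ 2))⁻¹)
      (-(t / (t ^ 2 + l ^ 2)) * (√(t ^ 2 + l ^ 2))⁻¹) t := by
  have hg : 0 < t ^ 2 + l ^ 2 := by positivity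
  have := ((((hasDerivAt_pow 2 t).add_const (l ^ 2)).sqrt hg.ne').inv (Real.sqrt_pos.2 hg).ne')
  refine this.congr_deriv ?_
  rw [Real.sq_sqrt hg.le]
  simp only [Nat.cast_ofNat, Nat.add_one_sub_one, pow_one]
  field_simp

/-- Future asymptotics of generic (`m ≠ 0`) scalar-field modes on the LRS vacuum
Bianchi VIII (NUT) solution: the mode equation `ψ'' + (f'/f)ψ' + Z_m ψ = 0`, with
`f(t) = t² − l² + 2μt` and `Z_m(t) = (m²/(4l²))((t²+l²)/f)² + (m²+Λ)/f`, has
fundamental solutions `t⁻¹ e^{±i|m/(2l)|(t − 2μ log t)}(1 + o(1))`. -/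
theorem bianchiVIII_generic_mode_asymptotics (l μ Λ : ℝ) (hl : 0 < l) (hΛ : 0 ≤ Λ)
    (m : ℤ) (hm : m ≠ 0)
    (f Z : ℝ → ℝ)
    (hf : ∀ t, f t = t ^ 2 - l ^ 2 + 2 * μ * t)
    (hZ : ∀ t, Z t = ((m : ℝ) ^ 2 / (4 * l ^ 2)) * ((t ^ 2 + l ^ 2) / f t) ^ 2 +
      ((m : ℝ) ^ 2 + Λ) / f t)
    (ε : ℝ) (hε : ε = 1 ∨ ε = -1) :
    ∃ t₀ : ℝ, (∀ t ∈ Ioi t₀, 0 < f t) ∧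
      ∃ ψ : ℝ → ℂ,
        (∀ t ∈ Ioi t₀, DifferentiableAt ℝ ψ t ∧ DifferentiableAt ℝ (deriv ψ) t) ∧
        (∀ t ∈ Ioi t₀,
          deriv (deriv ψ) t + (deriv f t / f t : ℂ) * deriv ψ t + (Z t : ℂ) * ψ t = 0) ∧
        Tendsto (fun t : ℝ => ψ t * (t : ℂ) *
            Complex.exp (-(ε : ℂ) * Complex.I * ((|(m : ℝ)| / (2 * l) : ℝ) : ℂ) *
              ((t : ℂ) - 2 * (μ : ℂ) * ((Real.log t : ℝ) : ℂ))))
          atTop (nhds 1) := by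
  obtain rfl : f = fun t => t ^ 2 - l ^ 2 + 2 * μ * t := funext hf
  beta_reduce at hZ
  obtain ⟨T₀, hT₀, φ, hφ, hφlim⟩ := exists_hasDerivAt_nut_phase hl μ
  have hg (t : ℝ) : 0 < t ^ 2 + l ^ 2 := by positivity
  have hε2 : ε ^ 2 = 1 := by rcases hε with rfl | rfl <;> norm_num
  set k : ℝ := |(m : ℝ)| / (2 * l) with hk
  have hk0 : 0 < k := by
    have : (m : ℝ) ≠ 0 := Int.cast_ne_zero.2 hm
    positivity
  have hk2 : (m : ℝ) ^ 2 / (4 * l ^ 2) = k ^ 2 := by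
    rw [hk, div_pow, sq_abs]
    ring
  set c : ℝ := (m : ℝ) ^ 2 + Λ
  let N (t : ℝ) : ℝ := (2 * t ^ 2 - l ^ 2) * (t ^ 2 - l ^ 2 + 2 * μ * t) / (t ^ 2 + l ^ 2) ^ 2 -
      (2 * t + 2 * μ) * t / (t ^ 2 + l ^ 2) + c
  have hNc : Continuous fun t => ε / k * N t := by
    have h0 (t : ℝ) : t ^ 2 + l ^ 2 ≠ 0 := (hg t).ne'
    fun_prop (disch := simp [h0])
  let ω (t : ℝ) : ℝ := ε * k * ((t ^ 2 + l ^ 2) / (t ^ 2 - l ^ 2 + 2 * μ * t))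
  let ρ (t : ℝ) : ℝ := (t ^ 2 + l ^ 2)⁻¹ * (ε / k * N t)
  have hρc : Continuous ρ :=
    (Continuous.inv₀ (by fun_prop) fun t => (hg t).ne').mul hNc
  have hρi : IntegrableOn ρ (Ioi T₀) := by
    refine IntegrableOn.mono_set (t := Ioi 1) ?_ (Ioi_subset_Ioi hT₀)
    refine Integrable.smul_bdd (integrableOn_inv_sq_add_sq l)
      (|ε / k| * (2 * (1 + 2 * |μ|) + (2 + 2 * |μ|) + |c|)) hNc.aestronglyMeasurable ?_
    filter_upwards [ae_restrict_mem measurableSet_Ioi] with t ht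
    rw [norm_mul]
    exact mul_le_mul_of_nonneg_left (abs_nut_error_le l μ c ht) (abs_nonneg _)
  obtain ⟨T, hT, S, D, hSD, hS⟩ := exists_perturbed_oscillator_tendsto (θ := fun t => ε * k * φ t)
    (ω := ω) (fun t ht => (hφ t ht).2.const_mul (ε * k)) hρc.continuousOn hρi
  let a (t : ℝ) : ℝ := (√(t ^ 2 + l ^ 2))⁻¹
  let τ (t : ℝ) : ℝ := t / (t ^ 2 + l ^ 2)
  let ψ' (t : ℝ) : ℂ := a t * (-τ t * S t + Complex.I * ω t * D t)
  have ha (t : ℝ) : HasDerivAt (fun t => (a t : ℂ)) (-τ t * a t) t := by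
    simpa [a, τ] using (hasDerivAt_inv_sqrt_sq_add_sq hl t).ofReal_comp
  have hf' (t : ℝ) : HasDerivAt (fun t => t ^ 2 - l ^ 2 + 2 * μ * t) (2 * t + 2 * μ) t := by
    refine (((hasDerivAt_pow 2 t).sub_const (l ^ 2)).add
      ((hasDerivAt_id t).const_mul (2 * μ))).congr_deriv ?_
    simp
  have hg' (t : ℝ) : HasDerivAt (fun t => t ^ 2 + l ^ 2) (2 * t) t := by
    simpa using (hasDerivAt_pow 2 t).add_const (l ^ 2)
  have hψ (t : ℝ) (ht : t ∈ Ioi T) : HasDerivAt (fun t => a t * S t) (ψ' t) t := by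
    refine ((ha t).mul (hSD t ht).1).congr_deriv ?_
    simp only [ψ']
    ring
  have hderiv (t : ℝ) (ht : t ∈ Ioi T) : deriv (fun t => a t * S t) =ᶠ[𝓝 t] ψ' := by
    filter_upwards [Ioi_mem_nhds ht] with s hs using (hψ s hs).deriv
  have hψ' (t : ℝ) (ht : t ∈ Ioi T) : ∃ ψ'' : ℂ, HasDerivAt ψ' ψ'' t ∧
      ψ'' + ((2 * t + 2 * μ : ℝ) / (t ^ 2 - l ^ 2 + 2 * μ * t : ℝ) : ℂ) * ψ' t +
        (Z t : ℂ) * (a t * S t) = 0 := by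
    have hft := (hφ t (hT.trans_lt ht)).1
    obtain ⟨τ', hτ, hτ'⟩ : ∃ τ', HasDerivAt τ τ' t ∧
        τ' = (1 * (t ^ 2 + l ^ 2) - t * (2 * t)) / (t ^ 2 + l ^ 2) ^ 2 :=
      ⟨_, (hasDerivAt_id t).div (hg' t) (hg t).ne', rfl⟩
    obtain ⟨ω', hω, hω'⟩ : ∃ ω', HasDerivAt ω ω' t ∧
        ω' = ε * k * ((2 * t * (t ^ 2 - l ^ 2 + 2 * μ * t) -
          (t ^ 2 + l ^ 2) * (2 * t + 2 * μ)) / (t ^ 2 - l ^ 2 + 2 * μ * t) ^ 2) :=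
      ⟨_, ((hg' t).div (hf' t) hft.ne').const_mul _, rfl⟩
    have hD0 : ω' - 2 * τ t * ω t +
        (2 * t + 2 * μ) / (t ^ 2 - l ^ 2 + 2 * μ * t) * ω t = 0 := by
      have := (hg t).ne'
      have := hft.ne'
      simp only [hω', τ, ω]
      field_simp
      ring
    have hωρ : ω t * ρ t = N t / (t ^ 2 - l ^ 2 + 2 * μ * t) := by
      have : ω t * ρ t = ε ^ 2 * (N t / (t ^ 2 - l ^ 2 + 2 * μ * t)) := by
        have := (hg t).ne'
        have := hft.ne'
        simp only [ω, ρ]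
        field_simp
      rw [this, hε2, one_mul]
    have hω2 : ω t ^ 2 = k ^ 2 * ((t ^ 2 + l ^ 2) / (t ^ 2 - l ^ 2 + 2 * μ * t)) ^ 2 := by
      simp only [ω, mul_pow, hε2, one_mul]
    have hS0 : τ t ^ 2 - τ' - ω t ^ 2 - ω t * ρ t -
        (2 * t + 2 * μ) / (t ^ 2 - l ^ 2 + 2 * μ * t) * τ t + Z t = 0 := by
      rw [hωρ, hω2, hZ, hk2, hτ']
      have := (hg t).ne'
      have := hft.ne'
      simp only [N, τ]
      generalize t ^ 2 - l ^ 2 + 2 * μ * t = F at this ⊢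
      field_simp
      ring
    refine ⟨_, (ha t).mul (((hτ.ofReal_comp.neg).mul (hSD t ht).1).add
      ((hω.ofReal_comp.const_mul Complex.I).mul (hSD t ht).2)), ?_⟩
    have hD0' := congrArg (fun x : ℝ => (x : ℂ)) hD0
    have hS0' := congrArg (fun x : ℝ => (x : ℂ)) hS0
    simp only [Complex.ofReal_add, Complex.ofReal_sub, Complex.ofReal_mul, Complex.ofReal_div,
      Complex.ofReal_pow, Complex.ofReal_zero, Complex.ofReal_ofNat] at hD0' hS0' ⊢
    simp only [ψ', Pi.neg_apply]
    linear_combination (a t * S t : ℂ) * hS0' + (Complex.I * a t * D t) * hD0' +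
      (a t * ω t * (ω t + ρ t) * S t) * Complex.I_sq
  refine ⟨T, fun t ht => (hφ t (hT.trans_lt ht)).1, fun t => a t * S t, fun t ht => ?_,
    fun t ht => ?_, ?_⟩
  · obtain ⟨_, h, -⟩ := hψ' t ht
    exact ⟨(hψ t ht).differentiableAt, h.differentiableAt.congr_of_eventuallyEq (hderiv t ht)⟩
  · obtain ⟨_, h, heq⟩ := hψ' t ht
    rw [(hderiv t ht).deriv_eq, h.deriv, (hψ t ht).deriv, (hf' t).deriv]
    exact heq
  · have ht : Tendsto (fun t : ℝ => ((t * a t : ℝ) : ℂ)) atTop (𝓝 1) := by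
      simpa [a, Function.comp_def] using
        (Complex.continuous_ofReal.tendsto 1).comp (tendsto_mul_inv_sqrt_sq_add_sq l)
    have he : Tendsto (fun t => Complex.exp (Complex.I *
        ((ε * k * (φ t - (t - 2 * μ * Real.log t)) : ℝ) : ℂ))) atTop (𝓝 1) := by
      have h : Tendsto (fun t => ε * k * (φ t - (t - 2 * μ * Real.log t))) atTop (𝓝 0) := by
        simpa using hφlim.const_mul (ε * k)
      have hcont : Continuous fun x : ℝ => Complex.exp (Complex.I * (x : ℂ)) := by fun_prop
      simpa [Function.comp_def] using (hcont.tendsto 0).comp h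
    have := (hS.mul ht).mul he
    simp only [mul_one] at this
    refine this.congr fun t => ?_
    have hexp : Complex.exp (-(ε : ℂ) * Complex.I * (k : ℂ) *
          ((t : ℂ) - 2 * (μ : ℂ) * ((Real.log t : ℝ) : ℂ))) =
        Complex.exp (-(Complex.I * ((ε * k * φ t : ℝ) : ℂ))) * Complex.exp (Complex.I *
          ((ε * k * (φ t - (t - 2 * μ * Real.log t)) : ℝ) : ℂ)) := by
      rw [← Complex.exp_add]
      congr 1
      push_cast
      ring
    rw [hexp]
    push_cast
    ring
end
end

section
/- Future asymptotics of U(1)-symmetric scalar-field modes on the LRS vacuum Bianchi VIII (NUT) solution: let l > 0, μ ∈ ℝ, Λ ≥ 0 with Λ ≠ 1/4, and set |s| = √|Λ − 1/4| and f(t) = t² − l² + 2μt. Consider the equation ψ''(t) + (f'(t)/f(t))·ψ'(t) + (Λ/f(t))·ψ(t) = 0. (i) If Λ > 1/4, then for each sign ε ∈ {+1,−1} there exist t₀ with f > 0 on (t₀,∞) and a twice differentiable solution ψ on (t₀,∞) with lim_{t→∞} ψ(t) · t^{1/2} · exp(−ε·i·|s|·log t) = 1. (ii) If 0 ≤ Λ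 < 1/4, then for each sign ε ∈ {+1,−1} there exist t₀ with f > 0 on (t₀,∞) and a twice differentiable solution ψ on (t₀,∞) with lim_{t→∞} ψ(t) · t^{1/2 − ε|s|} = 1. In other words, the fundamental solutions behave as t^{−1/2} e^{±i|s| log t}(1+o(1)) when Λ > 1/4 and as t^{−1/2 ± |s|}(1+o(1)) when 0 ≤ Λ < 1/4. -/
noncomputable section

open Set Filter

namespace LegendreAtInfinity

/-- Coefficients of the Frobenius solution at infinity, with exponent `ρ`, of
`(x² - A) y'' + 2 x y' - ρ (ρ + 1) y = 0`. -/
def coeff (A : ℝ) (ρ : ℂ) : ℕ → ℂ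
  | 0 => 1
  | k + 1 => coeff A ρ k *
      (A * ((ρ - 2 * k) * (ρ - 2 * k - 1)) / (2 * (k + 1) * (2 * k + 1 - 2 * ρ)))

lemma norm_exponent_le (ρ : ℂ) (k : ℕ) : ‖ρ - 2 * k‖ ≤ (‖ρ‖ + 3) * (k + 1) := by
  have h : ‖ρ - 2 * k‖ ≤ ‖ρ‖ + 2 * k := by
    refine (norm_sub_le _ _).trans ?_
    simp
  nlinarith [norm_nonneg ρ, (Nat.cast_nonneg k : (0 : ℝ) ≤ k),
    mul_nonneg (norm_nonneg ρ) (Nat.cast_nonneg k : (0 : ℝ) ≤ k)]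

lemma norm_exponent_sub_one_le (ρ : ℂ) (k : ℕ) :
    ‖ρ - 2 * k - 1‖ ≤ (‖ρ‖ + 3) * (k + 1) := by
  have h : ‖ρ - 2 * k - 1‖ ≤ ‖ρ‖ + 2 * k + 1 := by
    refine (norm_sub_le _ _).trans ?_
    have := norm_sub_le ρ (2 * k)
    simp at this ⊢
    linarith
  nlinarith [norm_nonneg ρ, (Nat.cast_nonneg k : (0 : ℝ) ≤ k),
    mul_nonneg (norm_nonneg ρ) (Nat.cast_nonneg k : (0 : ℝ) ≤ k)]

lemma le_norm_denominator {ρ : ℂ} (hρ : ρ.re ≤ 0) (k : ℕ) :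
    (k : ℝ) + 1 ≤ ‖2 * (k : ℂ) + 1 - 2 * ρ‖ := by
  refine le_trans ?_ (Complex.re_le_norm _)
  simp
  linarith [(Nat.cast_nonneg k : (0 : ℝ) ≤ k)]

lemma coeff_succ_mul {ρ : ℂ} (A : ℝ) (hρ : ρ.re ≤ 0) (k : ℕ) :
    coeff A ρ (k + 1) * (2 * (k + 1) * (2 * k + 1 - 2 * ρ)) =
      A * (coeff A ρ k * ((ρ - 2 * k) * (ρ - 2 * k - 1))) := by
  have h1 : (k : ℂ) + 1 ≠ 0 := Nat.cast_add_one_ne_zero k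
  have h2 : 2 * (k : ℂ) + 1 - 2 * ρ ≠ 0 :=
    norm_pos_iff.1 (lt_of_lt_of_le (by positivity) (le_norm_denominator hρ k))
  rw [coeff, mul_assoc, div_mul_cancel₀ _ (mul_ne_zero (mul_ne_zero two_ne_zero h1) h2)]
  ring

lemma norm_coeff_le {A : ℝ} {ρ : ℂ} (hA : 0 ≤ A) (hρ : ρ.re ≤ 0) (k : ℕ) :
    ‖coeff A ρ k‖ ≤ (A * (‖ρ‖ + 3) ^ 2) ^ k := by
  induction k with
  | zero => simp [coeff]
  | succ k ih =>
    rw [coeff, norm_mul, pow_succ]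
    refine mul_le_mul ih ?_ (norm_nonneg _) (by positivity)
    have hk : (0 : ℝ) < k + 1 := by positivity
    have hd := le_norm_denominator hρ k
    have hn : ‖(k : ℂ) + 1‖ = k + 1 := by
      rw [← Nat.cast_add_one, Complex.norm_natCast]; push_cast; rfl
    simp only [norm_div, norm_mul, hn, Complex.norm_real, Real.norm_of_nonneg hA,
      Complex.norm_ofNat]
    rw [div_le_iff₀ (mul_pos (by positivity) (hk.trans_le hd))]
    have h1 : ‖ρ - 2 * k‖ * ‖ρ - 2 * k - 1‖ ≤
        ((‖ρ‖ + 3) * (k + 1)) * ((‖ρ‖ + 3) * (k + 1)) :=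
      mul_le_mul (norm_exponent_le ρ k) (norm_exponent_sub_one_le ρ k) (norm_nonneg _)
        (by positivity)
    calc A * (‖ρ - 2 * k‖ * ‖ρ - 2 * k - 1‖)
        ≤ A * (((‖ρ‖ + 3) * (k + 1)) * ((‖ρ‖ + 3) * (k + 1))) := by gcongr
      _ = A * (‖ρ‖ + 3) ^ 2 * ((k + 1) * (k + 1)) := by ring
      _ ≤ A * (‖ρ‖ + 3) ^ 2 * (2 * (k + 1) * ‖2 * (k : ℂ) + 1 - 2 * ρ‖) := by
        gcongr
        linarith

/-- The generalised power series `∑ aₖ x ^ (ρ - 2 k)`. -/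
def series (a : ℕ → ℂ) (ρ : ℂ) (x : ℝ) : ℂ := ∑' k : ℕ, a k * (x : ℂ) ^ (ρ - 2 * k)

variable {a : ℕ → ℂ} {ρ : ℂ} {C M x₀ x : ℝ}

lemma norm_term_le (ha : ∀ k, ‖a k‖ ≤ C * M ^ k) (hρ : ρ.re ≤ 0) (hx₀ : 1 ≤ x₀)
    (hx : x₀ < x) (k : ℕ) :
    ‖a k * (x : ℂ) ^ (ρ - 2 * k)‖ ≤ C * (M / x₀ ^ 2) ^ k := by
  have hx0 : 0 < x := by linarith
  have h : x ^ (ρ - 2 * k).re ≤ ((x₀ ^ 2) ^ k)⁻¹ := by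
    have : (ρ - 2 * k).re = ρ.re + -((2 * k : ℕ) : ℝ) := by simp; ring
    rw [this, Real.rpow_add hx0, Real.rpow_neg hx0.le, Real.rpow_natCast, ← pow_mul]
    calc x ^ ρ.re * (x ^ (2 * k))⁻¹ ≤ 1 * (x₀ ^ (2 * k))⁻¹ := by
          gcongr
          exact Real.rpow_le_one_of_one_le_of_nonpos (by linarith) hρ
      _ = _ := one_mul _
  rw [norm_mul, Complex.norm_cpow_eq_rpow_re_of_pos hx0, div_pow, div_eq_mul_inv, ← mul_assoc]
  exact mul_le_mul (ha k) h (by positivity) ((norm_nonneg _).trans (ha k))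

lemma summable_bound (hM : 0 ≤ M) (hx₀ : 1 ≤ x₀) (hMx : M < x₀ ^ 2) :
    Summable fun k : ℕ => C * (M / x₀ ^ 2) ^ k :=
  (summable_geometric_of_lt_one (by positivity)
    ((div_lt_one (by positivity)).2 hMx)).mul_left C

lemma summable_term (ha : ∀ k, ‖a k‖ ≤ C * M ^ k) (hρ : ρ.re ≤ 0) (hM : 0 ≤ M)
    (hx₀ : 1 ≤ x₀) (hMx : M < x₀ ^ 2) (hx : x₀ < x) :
    Summable fun k : ℕ => a k * (x : ℂ) ^ (ρ - 2 * k) :=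
  .of_norm_bounded (summable_bound hM hx₀ hMx) (norm_term_le ha hρ hx₀ hx)

lemma hasDerivAt_series {C' : ℝ} (ha : ∀ k, ‖a k‖ ≤ C * M ^ k)
    (hb : ∀ k : ℕ, ‖a k * (ρ - 2 * k)‖ ≤ C' * M ^ k) (hρ : ρ.re ≤ 0) (hM : 0 ≤ M)
    (hx₀ : 1 ≤ x₀) (hMx : M < x₀ ^ 2) (hx : x₀ < x) :
    HasDerivAt (series a ρ) (series (fun k => a k * (ρ - 2 * k)) (ρ - 1) x) x := by
  have hρ' : (ρ - 1).re ≤ 0 := by simp; linarith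
  refine hasDerivAt_tsum_of_isPreconnected (t := Ioi x₀)
    (g := fun (k : ℕ) (y : ℝ) => a k * (y : ℂ) ^ (ρ - 2 * k))
    (g' := fun (k : ℕ) (y : ℝ) => a k * (ρ - 2 * k) * (y : ℂ) ^ (ρ - 1 - 2 * k))
    (summable_bound (C := C') hM hx₀ hMx)
    isOpen_Ioi isPreconnected_Ioi (fun k y hy => ?_)
    (fun k y hy => norm_term_le hb hρ' hx₀ hy k) hx
    (summable_term ha hρ hM hx₀ hMx hx) hx
  have hy0 : 0 < y := by have := mem_Ioi.1 hy; linarith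
  have h := ((hasDerivAt_id (y : ℂ)).cpow_const (c := ρ - 2 * k)
    (Complex.ofReal_mem_slitPlane.2 hy0)).comp_ofReal.const_mul (a k)
  refine h.congr_deriv ?_
  rw [sub_right_comm, mul_one, mul_assoc, id]

lemma tendsto_series_mul_cpow (ha : ∀ k, ‖a k‖ ≤ C * M ^ k) (hM : 0 ≤ M) :
    Tendsto (fun x : ℝ => series a ρ x * (x : ℂ) ^ (-ρ)) atTop (nhds (a 0)) := by
  have key : Tendsto (fun x : ℝ => ∑' k : ℕ, a k * (x : ℂ) ^ ((0 : ℂ) - 2 * k)) atTop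
      (nhds (∑' k : ℕ, if k = 0 then a 0 else 0)) := by
    refine tendsto_tsum_of_dominated_convergence
      (bound := fun k => C * (M / (M + 1) ^ 2) ^ k)
      (summable_bound hM (by linarith) (by nlinarith)) (fun k => ?_) ?_
    · rcases Nat.eq_zero_or_pos k with rfl | hk
      · simp
      · rw [if_neg hk.ne', tendsto_zero_iff_norm_tendsto_zero]
        have h2 : (0 : ℝ) < 2 * k := by positivity
        have := (tendsto_rpow_neg_atTop h2).const_mul ‖a k‖
        rw [mul_zero] at this
        refine this.congr' ?_
        filter_upwards [eventually_gt_atTop 0] with x hx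
        rw [norm_mul, Complex.norm_cpow_eq_rpow_re_of_pos hx]
        simp
    · filter_upwards [eventually_gt_atTop (M + 1)] with x hx k
      exact norm_term_le ha le_rfl (by linarith) hx k
  rw [tsum_ite_eq] at key
  refine key.congr' ?_
  filter_upwards [eventually_gt_atTop 0] with x hx
  have hx' : (x : ℂ) ≠ 0 := by exact_mod_cast hx.ne'
  rw [series, ← tsum_mul_right]
  congr 1 with k
  rw [mul_assoc, ← Complex.cpow_add _ _ hx']
  ring_nf

lemma norm_mul_exponent_le {c : ℂ} {K D R : ℝ} {k : ℕ} {d : ℂ} (hR : 0 ≤ R)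
    (hc : ‖c‖ ≤ D * K ^ k) (hd : ‖d‖ ≤ R * (k + 1)) :
    ‖c * d‖ ≤ D * R * (2 * K) ^ k := by
  have h2 : (k : ℝ) + 1 ≤ 2 ^ k := by exact_mod_cast Nat.lt_two_pow_self (n := k)
  calc ‖c * d‖ = ‖c‖ * ‖d‖ := norm_mul _ _
    _ ≤ (D * K ^ k) * (R * 2 ^ k) :=
      mul_le_mul hc (hd.trans (by gcongr)) (norm_nonneg _) ((norm_nonneg _).trans hc)
    _ = _ := by rw [mul_pow]; ring

/-- Solution at infinity of `(x² - A) y'' + 2 x y' - ρ (ρ + 1) y = 0` with `y ∼ x ^ ρ`. -/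
theorem exists_solution {A : ℝ} (hA : 0 ≤ A) (hρ : ρ.re ≤ 0) :
    ∃ x₁ : ℝ, (∀ x > x₁, 0 < x ^ 2 - A) ∧ ∃ y y' y'' : ℝ → ℂ,
      (∀ x > x₁, HasDerivAt y (y' x) x ∧ HasDerivAt y' (y'' x) x ∧
        ((x ^ 2 - A : ℝ) : ℂ) * y'' x + 2 * x * y' x - ρ * (ρ + 1) * y x = 0) ∧
      Tendsto (fun x : ℝ => y x * (x : ℂ) ^ (-ρ)) atTop (nhds 1) := by
  set R : ℝ := ‖ρ‖ + 3 with hR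
  set K : ℝ := A * R ^ 2 with hK
  have hR0 : 0 ≤ R := by positivity
  have hK0 : 0 ≤ K := by positivity
  set M : ℝ := 2 * (2 * K) with hM
  have hM0 : 0 ≤ M := by positivity
  set x₁ : ℝ := 1 + M + A with hx₁
  have hx1 : 1 ≤ x₁ := by linarith
  have hMx : M < x₁ ^ 2 := by nlinarith
  set c := coeff A ρ with hc
  have hc0 : ∀ k, ‖c k‖ ≤ 1 * K ^ k := fun k => by
    rw [one_mul]; exact norm_coeff_le hA hρ k
  have hc1 : ∀ k : ℕ, ‖c k * (ρ - 2 * k)‖ ≤ 1 * R * (2 * K) ^ k := fun k =>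
    norm_mul_exponent_le hR0 (hc0 k) (norm_exponent_le ρ k)
  have hc2 : ∀ k : ℕ, ‖c k * (ρ - 2 * k) * (ρ - 1 - 2 * k)‖ ≤ 1 * R * R * M ^ k := fun k =>
    norm_mul_exponent_le hR0 (hc1 k) (by
      rw [sub_right_comm]; exact norm_exponent_sub_one_le ρ k)
  have hc0' : ∀ k, ‖c k‖ ≤ 1 * M ^ k := fun k => (hc0 k).trans (by gcongr; linarith)
  have hc1' : ∀ k : ℕ, ‖c k * (ρ - 2 * k)‖ ≤ 1 * R * M ^ k := fun k =>
    (hc1 k).trans (by gcongr; linarith)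
  have hρ1 : (ρ - 1).re ≤ 0 := by simp; linarith
  have hρ2 : (ρ - 1 - 1).re ≤ 0 := by simp; linarith
  refine ⟨x₁, fun x hx => ?_, series c ρ, series (fun k => c k * (ρ - 2 * k)) (ρ - 1),
    series (fun k => c k * (ρ - 2 * k) * (ρ - 1 - 2 * k)) (ρ - 1 - 1),
    fun x hx => ⟨?_, ?_, ?_⟩, ?_⟩
  · nlinarith
  · exact hasDerivAt_series hc0' hc1' hρ hM0 hx1 hMx hx
  · exact hasDerivAt_series hc1' hc2 hρ1 hM0 hx1 hMx hx
  · have hx0 : 0 < x := by linarith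
    have hx' : (x : ℂ) ≠ 0 := by exact_mod_cast hx0.ne'
    have s0 := summable_term hc0' hρ hM0 hx1 hMx hx
    have s1 := summable_term hc1' hρ hM0 hx1 hMx hx
    have s2 := summable_term hc2 hρ hM0 hx1 hMx hx
    have e1 : (x : ℂ) * series (fun k => c k * (ρ - 2 * k)) (ρ - 1) x =
        ∑' k : ℕ, c k * (ρ - 2 * k) * (x : ℂ) ^ (ρ - 2 * k) := by
      rw [series, ← tsum_mul_left]
      congr 1 with k
      have : ρ - 2 * k = (ρ - 1 - 2 * k) + 1 := by ring
      conv_rhs => rw [this, Complex.cpow_add _ _ hx', Complex.cpow_one]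
      ring
    have e2 : (x : ℂ) ^ 2 *
        series (fun k => c k * (ρ - 2 * k) * (ρ - 1 - 2 * k)) (ρ - 1 - 1) x =
        ∑' k : ℕ, c k * (ρ - 2 * k) * (ρ - 1 - 2 * k) * (x : ℂ) ^ (ρ - 2 * k) := by
      rw [series, ← tsum_mul_left]
      congr 1 with k
      have : (x : ℂ) ^ (ρ - 2 * k) = (x : ℂ) ^ (ρ - 1 - 1 - 2 * k) * (x : ℂ) ^ 2 := by
        rw [← Complex.cpow_ofNat (x : ℂ) 2, ← Complex.cpow_add _ _ hx']
        congr 1; norm_num; ring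
      rw [this]; ring
    have e3 : (A : ℂ) * series (fun k => c k * (ρ - 2 * k) * (ρ - 1 - 2 * k)) (ρ - 1 - 1) x =
        ∑' k : ℕ, c (k + 1) * (2 * (k + 1) * (2 * k + 1 - 2 * ρ)) *
          (x : ℂ) ^ (ρ - 2 * (k + 1 : ℕ)) := by
      rw [series, ← tsum_mul_left]
      congr 1 with k
      rw [hc, coeff_succ_mul A hρ]
      have : ρ - 1 - 1 - 2 * k = ρ - 2 * (k + 1 : ℕ) := by push_cast; ring
      rw [this]; ring
    have e4 : ∑' k : ℕ, (c k * (ρ - 2 * k) * (ρ - 1 - 2 * k) * (x : ℂ) ^ (ρ - 2 * k) +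
          2 * (c k * (ρ - 2 * k) * (x : ℂ) ^ (ρ - 2 * k)) -
          ρ * (ρ + 1) * (c k * (x : ℂ) ^ (ρ - 2 * k))) =
        ∑' k : ℕ, c (k + 1) * (2 * (k + 1) * (2 * k + 1 - 2 * ρ)) *
          (x : ℂ) ^ (ρ - 2 * (k + 1 : ℕ)) := by
      rw [((s2.add (s1.mul_left 2)).sub (s0.mul_left _)).tsum_eq_zero_add]
      simp only [Nat.cast_zero]
      rw [show ∀ p q : ℂ, c 0 * (ρ - 2 * 0) * (ρ - 1 - 2 * 0) * q + 2 * (c 0 * (ρ - 2 * 0) * q) -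
        ρ * (ρ + 1) * (c 0 * q) + p = p by intros; ring]
      congr 1 with k
      push_cast
      ring
    rw [(s2.add (s1.mul_left 2)).tsum_sub (s0.mul_left _), s2.tsum_add (s1.mul_left 2),
      tsum_mul_left, tsum_mul_left, ← e1, ← e2, ← e3] at e4
    change _ - ρ * (ρ + 1) * series c ρ x = _ at e4
    push_cast
    linear_combination e4
  · have := tendsto_series_mul_cpow (ρ := ρ) hc0' hM0
    simpa [hc, coeff] using this

/-- Mode equation with translated argument: a solution asymptotic to `t ^ ρ`. -/
theorem exists_mode {l μ Λ : ℝ} {f : ℝ → ℝ} (hf : ∀ t, f t = t ^ 2 - l ^ 2 + 2 * μ * t)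
    (hρ : ρ.re ≤ 0) (hΛ : ρ * (ρ + 1) = -(Λ : ℂ)) :
    ∃ t₀ : ℝ, (∀ t ∈ Ioi t₀, 0 < f t) ∧
      ∃ ψ : ℝ → ℂ,
        (∀ t ∈ Ioi t₀, DifferentiableAt ℝ ψ t ∧ DifferentiableAt ℝ (deriv ψ) t) ∧
        (∀ t ∈ Ioi t₀,
          deriv (deriv ψ) t + (deriv f t / f t : ℂ) * deriv ψ t +
            ((Λ / f t : ℝ) : ℂ) * ψ t = 0) ∧
        Tendsto (fun t : ℝ => ψ t * (t : ℂ) ^ (-ρ)) atTop (nhds 1) := by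
  obtain ⟨x₁, hpos, y, y', y'', hy, hlim⟩ :=
    exists_solution (A := l ^ 2 + μ ^ 2) (by positivity) hρ
  have hfx : ∀ t, f t = (t + μ) ^ 2 - (l ^ 2 + μ ^ 2) := fun t => by rw [hf]; ring
  have hfpos : ∀ t ∈ Ioi (x₁ - μ), 0 < f t := fun t ht => by
    rw [hfx]; exact hpos _ (by have := mem_Ioi.1 ht; linarith)
  have hgt : ∀ t ∈ Ioi (x₁ - μ), t + μ > x₁ := fun t ht => by
    have := mem_Ioi.1 ht; linarith
  have hd1 : ∀ t ∈ Ioi (x₁ - μ), HasDerivAt (fun t => y (t + μ)) (y' (t + μ)) t :=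
    fun t ht => (hy _ (hgt t ht)).1.comp_add_const t μ
  have hd2 : ∀ t ∈ Ioi (x₁ - μ), HasDerivAt (deriv fun t => y (t + μ)) (y'' (t + μ)) t :=
    fun t ht => ((hy _ (hgt t ht)).2.1.comp_add_const t μ).congr_of_eventuallyEq <| by
      filter_upwards [Ioi_mem_nhds ht] with u hu using (hd1 u hu).deriv
  have hdf : ∀ t, deriv f t = 2 * (t + μ) := fun t => by
    have h : HasDerivAt f (2 * (t + μ)) t := by
      rw [funext hfx]
      have := (((hasDerivAt_id t).add_const μ).pow 2).sub_const (l ^ 2 + μ ^ 2)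
      refine this.congr_deriv ?_
      norm_num
    exact h.deriv
  refine ⟨x₁ - μ, hfpos, fun t => y (t + μ),
    fun t ht => ⟨(hd1 t ht).differentiableAt, (hd2 t ht).differentiableAt⟩, fun t ht => ?_, ?_⟩
  · have hne : (f t : ℂ) ≠ 0 := by exact_mod_cast (hfpos t ht).ne'
    have h := (hy _ (hgt t ht)).2.2
    rw [← hfx, hΛ] at h
    rw [(hd2 t ht).deriv, (hd1 t ht).deriv, hdf]
    push_cast at h ⊢
    field_simp
    linear_combination h
  · have h1 := hlim.comp (tendsto_atTop_add_const_right atTop μ tendsto_id)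
    have h2 : Tendsto (fun t : ℝ => (((t + μ) / t : ℝ) : ℂ) ^ ρ) atTop (nhds 1) := by
      have h3 : Tendsto (fun t : ℝ => (t + μ) / t) atTop (nhds 1) := by
        have : Tendsto (fun t : ℝ => 1 + μ * t⁻¹) atTop (nhds (1 + μ * 0)) :=
          (tendsto_inv_atTop_zero.const_mul μ).const_add 1
        rw [mul_zero, add_zero] at this
        refine this.congr' ?_
        filter_upwards [eventually_gt_atTop 0] with t ht
        field_simp
      have h4 : Tendsto (fun t : ℝ => (((t + μ) / t : ℝ) : ℂ)) atTop (nhds 1) := by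
        exact_mod_cast (Complex.continuous_ofReal.tendsto 1).comp h3
      simpa using h4.cpow (tendsto_const_nhds (x := ρ)) (by simp)
    have h5 := h1.mul h2
    rw [one_mul] at h5
    refine h5.congr' ?_
    filter_upwards [eventually_gt_atTop 0, eventually_gt_atTop (-μ)] with t ht ht'
    have hx : 0 < t + μ := by linarith
    have hxc : ((t + μ : ℝ) : ℂ) ≠ 0 := by exact_mod_cast hx.ne'
    have hp : ((t + μ : ℝ) : ℂ) ^ ρ ≠ 0 := fun h => hxc ((Complex.cpow_eq_zero_iff _ _).1 h).1
    have : (((t + μ) / t : ℝ) : ℂ) ^ ρ = ((t + μ : ℝ) : ℂ) ^ ρ * (t : ℂ) ^ (-ρ) := by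
      rw [div_eq_mul_inv, Complex.ofReal_mul, Complex.mul_cpow_ofReal_nonneg hx.le (by positivity),
        Complex.ofReal_inv, Complex.inv_cpow, Complex.cpow_neg]
      rw [Complex.arg_ofReal_of_nonneg ht.le]
      exact Real.pi_pos.ne
    simp only [Function.comp, id]
    rw [this, Complex.cpow_neg ((t + μ : ℝ) : ℂ)]
    field_simp

end LegendreAtInfinity

/-- Future asymptotics of the U(1)-symmetric (`m = 0`) scalar-field modes on the LRS
vacuum Bianchi VIII (NUT) solution: for the equation `ψ'' + (f'/f)ψ' + (Λ/f)ψ = 0` with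
`f(t) = t² − l² + 2μt`, the fundamental solutions behave as
`t^{-1/2} e^{±i|s| log t}(1+o(1))` when `Λ > 1/4`, and as `t^{-1/2 ± |s|}(1+o(1))` when
`0 ≤ Λ < 1/4`, where `|s| = √|Λ − 1/4|`. -/
theorem bianchiVIII_U1_mode_asymptotics (l μ Λ : ℝ) (hl : 0 < l) (hΛ : 0 ≤ Λ)
    (hΛne : Λ ≠ 1 / 4)
    (s : ℝ) (hs : s = Real.sqrt |Λ - 1 / 4|)
    (f : ℝ → ℝ) (hf : ∀ t, f t = t ^ 2 - l ^ 2 + 2 * μ * t)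
    (ε : ℝ) (hε : ε = 1 ∨ ε = -1) :
    (Λ > 1 / 4 →
      ∃ t₀ : ℝ, (∀ t ∈ Ioi t₀, 0 < f t) ∧
        ∃ ψ : ℝ → ℂ,
          (∀ t ∈ Ioi t₀, DifferentiableAt ℝ ψ t ∧ DifferentiableAt ℝ (deriv ψ) t) ∧
          (∀ t ∈ Ioi t₀,
            deriv (deriv ψ) t + (deriv f t / f t : ℂ) * deriv ψ t +
              ((Λ / f t : ℝ) : ℂ) * ψ t = 0) ∧
          Tendsto (fun t : ℝ => ψ t * ((t ^ ((1 : ℝ) / 2) : ℝ) : ℂ) *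
              Complex.exp (-(ε : ℂ) * Complex.I * (s : ℂ) * ((Real.log t : ℝ) : ℂ)))
            atTop (nhds 1)) ∧
    (Λ < 1 / 4 →
      ∃ t₀ : ℝ, (∀ t ∈ Ioi t₀, 0 < f t) ∧
        ∃ ψ : ℝ → ℂ,
          (∀ t ∈ Ioi t₀, DifferentiableAt ℝ ψ t ∧ DifferentiableAt ℝ (deriv ψ) t) ∧
          (∀ t ∈ Ioi t₀,
            deriv (deriv ψ) t + (deriv f t / f t : ℂ) * deriv ψ t +
              ((Λ / f t : ℝ) : ℂ) * ψ t = 0) ∧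
          Tendsto (fun t : ℝ => ψ t * ((t ^ ((1 : ℝ) / 2 - ε * s) : ℝ) : ℂ))
            atTop (nhds 1)) := by
  have hs2 : s ^ 2 = |Λ - 1 / 4| := by rw [hs, Real.sq_sqrt (abs_nonneg _)]
  have hs0 : 0 ≤ s := hs ▸ Real.sqrt_nonneg _
  have hε2 : ε ^ 2 = 1 := by rcases hε with rfl | rfl <;> norm_num
  refine ⟨fun h => ?_, fun h => ?_⟩
  · rw [abs_of_pos (by linarith)] at hs2
    have hc : ((s : ℂ)) ^ 2 = Λ - 1 / 4 := by
      rw [← Complex.ofReal_pow, hs2]; push_cast; ring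
    have hεc : ((ε : ℂ)) ^ 2 = 1 := by
      rw [← Complex.ofReal_pow, hε2, Complex.ofReal_one]
    obtain ⟨t₀, hpos, ψ, hd, hode, hlim⟩ := LegendreAtInfinity.exists_mode hf
      (ρ := -1 / 2 + ε * Complex.I * s) (Λ := Λ) (by norm_num)
      (by linear_combination ((ε : ℂ) * s) ^ 2 * Complex.I_sq - (s : ℂ) ^ 2 * hεc - hc)
    refine ⟨t₀, hpos, ψ, hd, hode, hlim.congr' ?_⟩
    filter_upwards [eventually_gt_atTop 0] with t ht
    have ht' : (t : ℂ) ≠ 0 := by exact_mod_cast ht.ne'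
    rw [mul_assoc (ψ t), Complex.ofReal_cpow ht.le, Complex.cpow_def_of_ne_zero ht',
      Complex.cpow_def_of_ne_zero ht', ← Complex.exp_add, Complex.ofReal_log ht.le]
    congr 2
    push_cast
    ring
  · rw [abs_of_neg (by linarith)] at hs2
    have hc : ((s : ℂ)) ^ 2 = -(Λ - 1 / 4) := by
      rw [← Complex.ofReal_pow, hs2]; push_cast; ring
    have hεc : ((ε : ℂ)) ^ 2 = 1 := by
      rw [← Complex.ofReal_pow, hε2, Complex.ofReal_one]
    have hs1 : s ≤ 1 / 2 := by nlinarith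
    have hre : -1 / 2 + ε * s ≤ 0 := by rcases hε with rfl | rfl <;> linarith
    obtain ⟨t₀, hpos, ψ, hd, hode, hlim⟩ := LegendreAtInfinity.exists_mode hf
      (ρ := ((-1 / 2 + ε * s : ℝ) : ℂ)) (Λ := Λ) (by rwa [Complex.ofReal_re])
      (by push_cast; linear_combination (s : ℂ) ^ 2 * hεc + hc)
    refine ⟨t₀, hpos, ψ, hd, hode, hlim.congr' ?_⟩
    filter_upwards [eventually_gt_atTop 0] with t ht
    rw [Complex.ofReal_cpow ht.le]
    congr 2
    push_cast
    ring
end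
end

section
/- Proper-time asymptotics of the LRS Bianchi VIII NUT solution: let l > 0, μ ∈ ℝ, and U(t) = (t² − l² + 2μt)/(t² + l²). Choose t₀ such that U(t) > 0 for all t ≥ t₀, and define the proper time τ(t) = ∫_{t₀}^{t} U(s)^{−1/2} ds for t ≥ t₀. Then there exist a constant c ∈ ℝ, a constant K > 0, and t₁ ≥ t₀ such that |τ(t) − t + μ·log t − c| ≤ K/t for all t ≥ t₁; i.e. τ = t − μ log t + O(1/t). -/
/-- A function on a ray whose derivative is bounded by `C / t ^ 2` converges at rate `C / t`. -/
theorem exists_abs_sub_le_div_of_abs_deriv_le {F h : ℝ → ℝ} {A C : ℝ} (hA : 0 < A)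
    (hF : ∀ t ≥ A, HasDerivAt F (h t) t) (hh : ∀ t ≥ A, |h t| ≤ C / t ^ 2) :
    ∃ c, ∀ t ≥ A, |F t - c| ≤ C / t := by
  have hdiv : ∀ t ≥ A, HasDerivAt (fun s : ℝ => C / s) (-(C / t ^ 2)) t := by
    intro t ht
    have ht0 : t ≠ 0 := (hA.trans_le ht).ne'
    simpa [div_eq_mul_inv] using (hasDerivAt_inv ht0).const_mul C
  have hmono : MonotoneOn (fun t => F t - C / t) (Set.Ici A) := by
    refine monotoneOn_of_hasDerivWithinAt_nonneg (convex_Ici A)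
      (fun t ht => ((hF t ht).sub (hdiv t ht)).continuousAt.continuousWithinAt)
      (fun t ht => ((hF t (interior_subset ht)).sub
        (hdiv t (interior_subset ht))).hasDerivWithinAt) ?_
    intro t ht
    linarith [(abs_le.1 (hh t (interior_subset ht))).1]
  have hanti : AntitoneOn (fun t => F t + C / t) (Set.Ici A) := by
    refine antitoneOn_of_hasDerivWithinAt_nonpos (convex_Ici A)
      (fun t ht => ((hF t ht).add (hdiv t ht)).continuousAt.continuousWithinAt)
      (fun t ht => ((hF t (interior_subset ht)).add
        (hdiv t (interior_subset ht))).hasDerivWithinAt) ?_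
    intro t ht
    linarith [(abs_le.1 (hh t (interior_subset ht))).2]
  have hC : ∀ t ≥ A, 0 ≤ C / t := by
    intro t ht
    have ht0 : 0 < t := hA.trans_le ht
    have h0 : 0 ≤ C / t ^ 2 := (abs_nonneg _).trans (hh t ht)
    have : C / t = C / t ^ 2 * t := by field_simp
    rw [this]
    positivity
  have hle : ∀ s ≥ A, ∀ t ≥ A, F s - C / s ≤ F t + C / t := by
    intro s hs t ht
    rcases le_total s t with hst | hts
    · have := hmono hs ht hst
      simp only at this
      linarith [hC t ht]
    · have := hanti ht hs hts
      simp only at this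
      linarith [hC s hs]
  set S := (fun t => F t - C / t) '' Set.Ici A
  have hne : S.Nonempty := ⟨_, A, Set.self_mem_Ici, rfl⟩
  have hub : ∀ t ≥ A, F t + C / t ∈ upperBounds S := by
    rintro t ht _ ⟨s, hs, rfl⟩
    exact hle s hs t ht
  refine ⟨sSup S, fun t ht => ?_⟩
  have h1 : F t - C / t ≤ sSup S := le_csSup ⟨_, hub t ht⟩ ⟨t, ht, rfl⟩
  have h2 : sSup S ≤ F t + C / t := csSup_le hne (hub t ht)
  rw [abs_le]
  constructor <;> linarith

/-- The second-order error bound for the lapse of the Bianchi VIII NUT solution. -/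
theorem abs_nut_lapse_sub_le {l μ s : ℝ} (hs : 1 + 2 * l ^ 2 + 4 * |μ| ≤ s) :
    |((s ^ 2 - l ^ 2 + 2 * μ * s) / (s ^ 2 + l ^ 2)) ^ (-(1 / 2 : ℝ)) - 1 + μ / s| ≤
      4 * (2 * l ^ 2 + 3 * μ ^ 2 + 2 * |μ| * l ^ 2 + 2 * |μ| ^ 3 + μ ^ 2 * l ^ 2) / s ^ 2 := by
  have hμ0 := abs_nonneg μ
  have hl0 := sq_nonneg l
  have hs1 : 1 ≤ s := by linarith
  have hs0 : 0 < s := by linarith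
  have hD : s ^ 2 / 2 ≤ s ^ 2 - l ^ 2 + 2 * μ * s := by
    nlinarith [neg_abs_le μ]
  have hDpos : 0 < s ^ 2 - l ^ 2 + 2 * μ * s := lt_of_lt_of_le (by positivity) hD
  have hN : 0 < s ^ 2 + l ^ 2 := by positivity
  set u := (s ^ 2 - l ^ 2 + 2 * μ * s) / (s ^ 2 + l ^ 2) with hu
  have hupos : 0 < u := div_pos hDpos hN
  set r := u ^ (-(1 / 2 : ℝ)) with hr
  have hrpos : 0 < r := Real.rpow_pos_of_pos hupos _
  have hr2 : r ^ 2 = (s ^ 2 + l ^ 2) / (s ^ 2 - l ^ 2 + 2 * μ * s) := by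
    rw [hr, ← Real.rpow_natCast, ← Real.rpow_mul hupos.le]
    norm_num
    rw [Real.rpow_neg_one, hu, inv_div]
  set p := 1 - μ / s with hp
  have hp2 : 1 / 2 ≤ p := by
    have : μ / s ≤ 1 / 2 := by
      rw [div_le_iff₀ hs0]
      linarith [le_abs_self μ]
    linarith
  set M := 2 * l ^ 2 + 3 * μ ^ 2 + 2 * |μ| * l ^ 2 + 2 * |μ| ^ 3 + μ ^ 2 * l ^ 2 with hM
  have hMnn : 0 ≤ M := by positivity
  have hid : r ^ 2 - p ^ 2 =
      (s ^ 2 * (2 * l ^ 2 + 3 * μ ^ 2) - s * (μ * (2 * l ^ 2 + 2 * μ ^ 2)) + μ ^ 2 * l ^ 2) /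
        (s ^ 2 * (s ^ 2 - l ^ 2 + 2 * μ * s)) := by
    have hps : p = (s - μ) / s := by
      rw [hp]
      field_simp
    rw [hr2, hps, div_pow, div_sub_div _ _ hDpos.ne' (by positivity),
      div_eq_div_iff (by positivity) (by positivity)]
    ring
  have hnum : |s ^ 2 * (2 * l ^ 2 + 3 * μ ^ 2) - s * (μ * (2 * l ^ 2 + 2 * μ ^ 2)) + μ ^ 2 * l ^ 2|
      ≤ M * s ^ 2 := by
    have hss : s ≤ s ^ 2 := by nlinarith
    have hb : |s * (μ * (2 * l ^ 2 + 2 * μ ^ 2))| ≤ s ^ 2 * (|μ| * (2 * l ^ 2 + 2 * μ ^ 2)) := by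
      rw [abs_mul, abs_mul, abs_of_pos hs0, abs_of_nonneg (by positivity : 0 ≤ 2 * l ^ 2 + 2 * μ ^ 2)]
      gcongr
    have hc : μ ^ 2 * l ^ 2 ≤ μ ^ 2 * l ^ 2 * s ^ 2 :=
      le_mul_of_one_le_right (by positivity) (by nlinarith)
    have ha : 0 ≤ s ^ 2 * (2 * l ^ 2 + 3 * μ ^ 2) := by positivity
    have hd : 0 ≤ μ ^ 2 * l ^ 2 := by positivity
    have hMs : M * s ^ 2 = s ^ 2 * (2 * l ^ 2 + 3 * μ ^ 2) +
        s ^ 2 * (|μ| * (2 * l ^ 2 + 2 * μ ^ 2)) + μ ^ 2 * l ^ 2 * s ^ 2 := by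
      rw [hM, ← sq_abs μ]
      ring
    rw [hMs]
    obtain ⟨hb1, hb2⟩ := abs_le.1 hb
    rw [abs_le]
    constructor <;> linarith
  have hsq : |r ^ 2 - p ^ 2| ≤ 2 * M / s ^ 2 := by
    rw [hid, abs_div, abs_of_pos (by positivity : 0 < s ^ 2 * (s ^ 2 - l ^ 2 + 2 * μ * s))]
    calc _ ≤ M * s ^ 2 / (s ^ 2 * (s ^ 2 / 2)) := by gcongr
      _ = 2 * M / s ^ 2 := by field_simp
  have hfac : |r ^ 2 - p ^ 2| = |r - p| * (r + p) := by
    rw [sq_sub_sq, abs_mul, abs_of_pos (by linarith : 0 < r + p), mul_comm]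
  have hrp : |r - 1 + μ / s| = |r - p| := by
    rw [hp]
    ring_nf
  have h4 : 4 * M / s ^ 2 = 2 * (2 * M / s ^ 2) := by ring
  rw [hrp, h4]
  nlinarith [abs_nonneg (r - p)]



/-- Proper-time asymptotics of the LRS Bianchi VIII NUT solution: with
`U(t) = (t² − l² + 2μt)/(t² + l²)` and proper time `τ(t) = ∫_{t₀}^t U(s)^{-1/2} ds`,
one has `τ = t − μ log t + O(1/t)` (up to an additive constant). -/
theorem bianchiVIII_proper_time_asymptotics (l μ : ℝ) (hl : 0 < l)
    (U : ℝ → ℝ) (hU : ∀ t, U t = (t ^ 2 - l ^ 2 + 2 * μ * t) / (t ^ 2 + l ^ 2))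
    (t₀ : ℝ) (ht₀ : ∀ t ≥ t₀, 0 < U t)
    (τ : ℝ → ℝ) (hτ : ∀ t, τ t = ∫ s in t₀..t, (U s) ^ (-(1 / 2 : ℝ))) :
    ∃ (c K t₁ : ℝ), 0 < K ∧ t₀ ≤ t₁ ∧
      ∀ t ≥ t₁, |τ t - t + μ * Real.log t - c| ≤ K / t := by
  have hcont : ContinuousOn (fun s => (U s) ^ (-(1 / 2 : ℝ))) (Set.Ici t₀) := by
    have hUc : Continuous U := by
      rw [funext hU]
      exact Continuous.div (by fun_prop) (by fun_prop) fun t => by positivity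
    exact hUc.continuousOn.rpow_const fun t ht => Or.inl (ht₀ t ht).ne'
  set A := |t₀| + (1 + 2 * l ^ 2 + 4 * |μ|)
  have hAt : t₀ < A := by
    have : 0 < 1 + 2 * l ^ 2 + 4 * |μ| := by positivity
    linarith [le_abs_self t₀]
  have hA0 : 0 < A := by positivity
  set M := 2 * l ^ 2 + 3 * μ ^ 2 + 2 * |μ| * l ^ 2 + 2 * |μ| ^ 3 + μ ^ 2 * l ^ 2
  have hderiv : ∀ t ≥ A, HasDerivAt (fun t => τ t - t + μ * Real.log t)
      ((U t) ^ (-(1 / 2 : ℝ)) - 1 + μ / t) t := by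
    intro t ht
    have htt : t₀ < t := hAt.trans_le ht
    have hint : IntervalIntegrable (fun s => (U s) ^ (-(1 / 2 : ℝ))) MeasureTheory.volume t₀ t :=
      (hcont.mono (by rw [Set.uIcc_of_le htt.le]; exact Set.Icc_subset_Ici_self)).intervalIntegrable
    have hτd : HasDerivAt τ ((U t) ^ (-(1 / 2 : ℝ))) t := by
      rw [funext hτ]
      exact intervalIntegral.integral_hasDerivAt_right hint
        ((hcont.mono Set.Ioi_subset_Ici_self).stronglyMeasurableAtFilter isOpen_Ioi t htt)
        (hcont.continuousAt (Ici_mem_nhds htt))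
    exact (hτd.sub (hasDerivAt_id t)).add
      ((Real.hasDerivAt_log (hA0.trans_le ht).ne').const_mul μ)
  obtain ⟨c, hc⟩ := exists_abs_sub_le_div_of_abs_deriv_le (C := 4 * M) hA0 hderiv fun t ht => by
    rw [hU t]
    exact abs_nut_lapse_sub_le (by linarith [abs_nonneg t₀])
  exact ⟨c, 4 * M, A, by positivity, hAt.le, hc⟩
end

section
/- Future asymptotics of scalar-field modes on the LRS vacuum Bianchi III solution: let l > 0, μ ∈ ℝ, m ∈ ℤ, λ² ≥ 0, and consider on (t₀,∞) with t₀ > |μ| the equation ψ''(t) + (2t/(t² − μ²))·ψ'(t) + ( λ²/(t² − μ²) + (m/(2l))²·((t − μ)/(t + μ))² )·ψ(t) = 0. Set |s| = √|λ² − 1/4|. Then: (i) if m ≠ 0, for each sign ε ∈ {+1,−1} there exist t₁ ≥ t₀ and a twice differentiable solution ψ on (t₁,∞) with lim_{t→∞} ψ(t) · t · exp(−ε·i·(|m|/(2l))·(t − 2μ·log t)) = 1; (ii) if m = 0 and λ² > 1/4, for each sign ε there exist t₁ ≥ t₀ and a solution ψ on (t₁,∞) with lim_{t→∞} ψ(t)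 · t^{1/2} · exp(−ε·i·|s|·log t) = 1; (iii) if m = 0 and 0 ≤ λ² < 1/4, for each sign ε there exist t₁ ≥ t₀ and a solution ψ on (t₁,∞) with lim_{t→∞} ψ(t) · t^{1/2 − ε|s|} = 1. Thus the fundamental solutions are t^{−1} e^{±i|m/(2l)|(t − 2μ log t)}(1+o(1)) for m ≠ 0, t^{−1/2} e^{±i|s| log t}(1+o(1)) for m = 0 and λ² > 1/4, and t^{−1/2 ± |s|}(1+o(1)) for m = 0 and 0 ≤ λ² < 1/4 — the same asymptotic forms as for the LRS Bianchi VIII model with Λ in place of λ². -/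
noncomputable section

open Set Filter

open MeasureTheory Topology
open scoped BoundedContinuousFunction

theorem hasDerivAt_integral_Ioi {f : ℝ → ℂ} {T t : ℝ} (hf : IntegrableOn f (Ioi T))
    (hfc : ContinuousOn f (Ioi T)) (ht : T < t) :
    HasDerivAt (fun u => ∫ x in Ioi u, f x) (-f t) t := by
  have hint : IntervalIntegrable f volume T t :=
    (intervalIntegrable_iff_integrableOn_Ioc_of_le ht.le).2 (hf.mono_set Ioc_subset_Ioi_self)
  have hd := (intervalIntegral.integral_hasDerivAt_right hint
    (hfc.stronglyMeasurableAtFilter isOpen_Ioi t ht)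
    (hfc.continuousAt (Ioi_mem_nhds ht))).const_sub (∫ x in Ioi T, f x)
  refine hd.congr_of_eventuallyEq ?_
  filter_upwards [Ioi_mem_nhds ht] with u hu
  rw [← intervalIntegral.integral_interval_add_Ioi hf (hf.mono_set (Ioi_subset_Ioi (le_of_lt hu)))]
  ring

section PerturbedConstant

variable {V F : ℝ → ℂ} {T C : ℝ}

theorem integrableOn_mul_boundedContinuous (hF : IntegrableOn F (Ioi T)) (h : ℝ →ᵇ ℂ) :
    IntegrableOn (fun y => F y * h y) (Ioi T) :=
  hF.mul_bdd (c := ‖h‖) h.continuous.aestronglyMeasurable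
    (Eventually.of_forall fun x => h.norm_coe_le_norm x)

theorem hasDerivAt_inner (hF : IntegrableOn F (Ioi T)) (hFc : ContinuousOn F (Ioi T))
    (h : ℝ →ᵇ ℂ) {t : ℝ} (ht : T < t) :
    HasDerivAt (fun x => ∫ y in Ioi x, F y * h y) (-(F t * h t)) t :=
  hasDerivAt_integral_Ioi (integrableOn_mul_boundedContinuous hF h)
    (hFc.mul h.continuous.continuousOn) ht

theorem norm_mul_inner_le (hF : IntegrableOn F (Ioi T))
    (hVF : ∀ x > T, ‖V x‖ * ∫ y in Ioi x, ‖F y‖ ≤ C * x ^ (-2 : ℝ)) (h : ℝ →ᵇ ℂ) {x : ℝ}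
    (hx : T < x) :
    ‖V x * ∫ y in Ioi x, F y * h y‖ ≤ ‖h‖ * C * x ^ (-2 : ℝ) := by
  have hFx := hF.mono_set (Ioi_subset_Ioi hx.le)
  have h1 : ‖∫ y in Ioi x, F y * h y‖ ≤ ∫ y in Ioi x, ‖F y‖ * ‖h‖ := by
    refine norm_integral_le_of_norm_le (hFx.norm.mul_const _) (Eventually.of_forall fun y => ?_)
    rw [norm_mul]
    exact mul_le_mul_of_nonneg_left (h.norm_coe_le_norm y) (norm_nonneg _)
  rw [integral_mul_const] at h1
  rw [norm_mul]
  calc _ ≤ ‖V x‖ * ((∫ y in Ioi x, ‖F y‖) * ‖h‖) := by gcongr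
    _ = ‖h‖ * (‖V x‖ * ∫ y in Ioi x, ‖F y‖) := by ring
    _ ≤ ‖h‖ * (C * x ^ (-2 : ℝ)) := mul_le_mul_of_nonneg_left (hVF x hx) (norm_nonneg _)
    _ = _ := by ring

theorem integrableOn_mul_inner (hT : 0 < T) (hF : IntegrableOn F (Ioi T))
    (hFc : ContinuousOn F (Ioi T)) (hVc : ContinuousOn V (Ioi T))
    (hVF : ∀ x > T, ‖V x‖ * ∫ y in Ioi x, ‖F y‖ ≤ C * x ^ (-2 : ℝ)) (h : ℝ →ᵇ ℂ) :
    IntegrableOn (fun x => V x * ∫ y in Ioi x, F y * h y) (Ioi T) := by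
  refine Integrable.mono' (g := fun x => ‖h‖ * C * x ^ (-2 : ℝ))
    ((integrableOn_Ioi_rpow_of_lt (by norm_num) hT).const_mul _) ?_ ?_
  · exact (hVc.mul fun x hx =>
      (hasDerivAt_inner hF hFc h hx).continuousAt.continuousWithinAt).aestronglyMeasurable
      measurableSet_Ioi
  · exact (ae_restrict_iff' measurableSet_Ioi).2
      (Eventually.of_forall fun x hx => norm_mul_inner_le hF hVF h hx)

theorem norm_outer_le (hT : 0 < T) (hF : IntegrableOn F (Ioi T))
    (hVF : ∀ x > T, ‖V x‖ * ∫ y in Ioi x, ‖F y‖ ≤ C * x ^ (-2 : ℝ)) (h : ℝ →ᵇ ℂ) {t : ℝ}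
    (ht : T ≤ t) :
    ‖∫ x in Ioi t, V x * ∫ y in Ioi x, F y * h y‖ ≤ ‖h‖ * C * t⁻¹ := by
  have ht0 : 0 < t := hT.trans_le ht
  have h1 : ‖∫ x in Ioi t, V x * ∫ y in Ioi x, F y * h y‖
      ≤ ∫ x in Ioi t, ‖h‖ * C * x ^ (-2 : ℝ) :=
    norm_integral_le_of_norm_le
      ((integrableOn_Ioi_rpow_of_lt (by norm_num) ht0).const_mul _)
      ((ae_restrict_iff' measurableSet_Ioi).2
        (Eventually.of_forall fun x hx => norm_mul_inner_le hF hVF h (ht.trans_lt hx)))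
  rw [integral_const_mul, integral_Ioi_rpow_of_lt (by norm_num) ht0] at h1
  convert h1 using 2
  norm_num [Real.rpow_neg_one]

/-- The equation `(h' / V)' = -F h` has a solution tending to `1` at infinity. -/
theorem exists_perturbed_constant_solution (hT : 0 < T) (hF : IntegrableOn F (Ioi T))
    (hFc : ContinuousOn F (Ioi T)) (hVc : ContinuousOn V (Ioi T))
    (hVF : ∀ x > T, ‖V x‖ * ∫ y in Ioi x, ‖F y‖ ≤ C * x ^ (-2 : ℝ)) :
    ∃ T₁ ≥ T, ∃ h G : ℝ → ℂ, Tendsto h atTop (𝓝 1) ∧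
      ∀ t > T₁, HasDerivAt h (V t * G t) t ∧ HasDerivAt G (-(F t * h t)) t := by
  have hint := integrableOn_mul_inner hT hF hFc hVc hVF
  have hcont (h : ℝ →ᵇ ℂ) : ContinuousOn (fun x => V x * ∫ y in Ioi x, F y * h y) (Ioi T) :=
    hVc.mul fun x hx => (hasDerivAt_inner hF hFc h hx).continuousAt.continuousWithinAt
  have hder (h : ℝ →ᵇ ℂ) {t : ℝ} (ht : T < t) :=
    hasDerivAt_integral_Ioi (hint h) (hcont h) ht
  have hbound (h : ℝ →ᵇ ℂ) {t : ℝ} (ht : T ≤ t) := norm_outer_le hT hF hVF h ht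
  obtain ⟨T₁, hTT₁, hCT₁⟩ : ∃ T₁ > T, C * T₁⁻¹ ≤ 1 / 2 := by
    have h0 : Tendsto (fun t : ℝ => C * t⁻¹) atTop (𝓝 0) := by
      simpa using tendsto_inv_atTop_zero.const_mul C
    exact ((eventually_gt_atTop T).and (h0.eventually_le_const (by norm_num))).exists
  have hC : 0 ≤ C := by
    have h1 := (hVF T₁ hTT₁).trans' (mul_nonneg (norm_nonneg _)
      (integral_nonneg fun _ => norm_nonneg _))
    exact nonneg_of_mul_nonneg_left h1 (Real.rpow_pos_of_pos (hT.trans hTT₁) _)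
  have hmax (t : ℝ) : T < max t T₁ := lt_max_of_lt_right hTT₁
  have hhalf (h : ℝ →ᵇ ℂ) (t : ℝ) :
      ‖∫ x in Ioi (max t T₁), V x * ∫ y in Ioi x, F y * h y‖ ≤ 1 / 2 * ‖h‖ := by
    refine (hbound h (hmax t).le).trans ?_
    have : (max t T₁)⁻¹ ≤ T₁⁻¹ := inv_anti₀ (hT.trans hTT₁) (le_max_right _ _)
    calc ‖h‖ * C * (max t T₁)⁻¹ ≤ ‖h‖ * C * T₁⁻¹ := by gcongr
      _ = (C * T₁⁻¹) * ‖h‖ := by ring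
      _ ≤ _ := by gcongr
  let K (h : ℝ →ᵇ ℂ) : ℝ →ᵇ ℂ := BoundedContinuousFunction.ofNormedAddCommGroup
    (fun t => 1 - ∫ x in Ioi (max t T₁), V x * ∫ y in Ioi x, F y * h y)
    (continuous_const.sub (continuous_iff_continuousAt.2 fun t =>
      ContinuousAt.comp (f := fun t => max t T₁)
        (g := fun u => ∫ x in Ioi u, V x * ∫ y in Ioi x, F y * h y)
        (hder h (hmax t)).continuousAt (by fun_prop)))
    (1 + 1 / 2 * ‖h‖)
    (fun t => (norm_sub_le _ _).trans (by rw [norm_one]; gcongr; exact hhalf h t))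
  have hKapp (h : ℝ →ᵇ ℂ) (t : ℝ) :
      K h t = 1 - ∫ x in Ioi (max t T₁), V x * ∫ y in Ioi x, F y * h y := rfl
  have hK : ContractingWith (1 / 2 : NNReal) K := by
    refine ⟨by rw [div_lt_one] <;> norm_num, LipschitzWith.of_dist_le_mul fun g h => ?_⟩
    refine (BoundedContinuousFunction.dist_le (by positivity)).2 fun t => ?_
    have hsub : K g t - K h t
        = ∫ x in Ioi (max t T₁), V x * ∫ y in Ioi x, F y * (h - g) y := by
      have hs := Ioi_subset_Ioi (hmax t).le
      rw [hKapp, hKapp, sub_sub_sub_cancel_left,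
        ← integral_sub ((hint h).mono_set hs) ((hint g).mono_set hs)]
      refine setIntegral_congr_fun measurableSet_Ioi fun x hx => ?_
      have hs' := Ioi_subset_Ioi ((hmax t).trans hx).le
      rw [← mul_sub, ← integral_sub
        ((integrableOn_mul_boundedContinuous hF h).mono_set hs')
        ((integrableOn_mul_boundedContinuous hF g).mono_set hs')]
      simp [mul_sub]
    rw [dist_eq_norm, hsub, dist_comm, dist_eq_norm]
    simpa using hhalf (h - g) t
  obtain ⟨h, hfix⟩ : ∃ h, K h = h := ⟨_, hK.fixedPoint_isFixedPt⟩
  refine ⟨T₁, hTT₁.le, h, fun x => ∫ y in Ioi x, F y * h y, ?_, fun t ht => ⟨?_, ?_⟩⟩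
  · refine tendsto_iff_norm_sub_tendsto_zero.2 (squeeze_zero' (g := fun t => ‖h‖ * C * t⁻¹)
      (Eventually.of_forall fun _ => norm_nonneg _) ?_
      (by simpa using tendsto_inv_atTop_zero.const_mul (‖h‖ * C)))
    filter_upwards [eventually_ge_atTop T₁] with t ht
    rw [← hfix, hKapp, hfix, max_eq_left ht, sub_sub_cancel_left, norm_neg]
    exact hbound h (hTT₁.le.trans ht)
  · have hd := (hder h (hTT₁.trans ht)).const_sub 1
    rw [neg_neg] at hd
    refine hd.congr_of_eventuallyEq ?_
    filter_upwards [Ioi_mem_nhds ht] with u hu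
    rw [← hfix, hKapp, hfix, max_eq_left (le_of_lt hu)]
  · exact hasDerivAt_inner hF hFc h (hTT₁.trans ht)

end PerturbedConstant

section ExponentialAnsatz

/-- The exponent of the formal solution `exp (c₀ t + c₁ log t - c₂ / t)`. -/
def ansatzExponent (c₀ c₁ c₂ : ℂ) (t : ℝ) : ℂ := c₀ * t + c₁ * (Real.log t : ℝ) - c₂ / t

/-- The derivative of `ansatzExponent`. -/
def ansatzSlope (c₀ c₁ c₂ : ℂ) (t : ℝ) : ℂ := c₀ + c₁ / t + c₂ / t ^ 2

/-- The quotient by `exp (ansatzExponent c₀ c₁ c₂)` of the mode operator applied to it. -/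
def ansatzResidual (c₀ c₁ c₂ μ lam w : ℂ) (t : ℝ) : ℂ :=
  (-c₁ / t ^ 2 - 2 * c₂ / t ^ 3) + ansatzSlope c₀ c₁ c₂ t ^ 2 +
    2 * t / (t ^ 2 - μ ^ 2) * ansatzSlope c₀ c₁ c₂ t +
    (lam / (t ^ 2 - μ ^ 2) + w * ((t - μ) / (t + μ)) ^ 2)

variable {c₀ c₁ c₂ : ℂ} {t : ℝ}

theorem hasDerivAt_ansatzExponent (ht : 0 < t) :
    HasDerivAt (ansatzExponent c₀ c₁ c₂) (ansatzSlope c₀ c₁ c₂ t) t := by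
  have ht' : (t : ℂ) ≠ 0 := by exact_mod_cast ht.ne'
  have hid : HasDerivAt (fun x : ℝ => (x : ℂ)) 1 t := (hasDerivAt_id t).ofReal_comp
  have hlog := (Real.hasDerivAt_log ht.ne').ofReal_comp
  have hinv := hid.inv ht'
  refine (((hid.const_mul c₀).add (hlog.const_mul c₁)).sub (hinv.const_mul c₂)).congr_deriv ?_
  rw [ansatzSlope]
  push_cast
  ring

theorem hasDerivAt_ansatzSlope (ht : 0 < t) :
    HasDerivAt (ansatzSlope c₀ c₁ c₂) (-c₁ / t ^ 2 - 2 * c₂ / t ^ 3) t := by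
  have ht' : (t : ℂ) ≠ 0 := by exact_mod_cast ht.ne'
  have hid : HasDerivAt (fun x : ℝ => (x : ℂ)) 1 t := (hasDerivAt_id t).ofReal_comp
  have h1 := (hid.inv ht').const_mul c₁
  have h2 := ((hid.pow 2).inv (pow_ne_zero 2 ht')).const_mul c₂
  refine ((h1.const_add c₀).add h2).congr_deriv ?_
  simp only [Pi.pow_apply]
  field_simp
  ring

theorem re_ansatzExponent (hc₀ : c₀.re = 0) :
    (ansatzExponent c₀ c₁ c₂ t).re = Real.log t * c₁.re - c₂.re / t := by
  simp [ansatzExponent, hc₀, mul_comm]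

theorem norm_exp_ansatzExponent_le (hc₀ : c₀.re = 0) (ht : 1 ≤ t) (κ : ℝ) (hκ : |κ| ≤ 2) :
    ‖Complex.exp (κ * ansatzExponent c₀ c₁ c₂ t)‖
      ≤ t ^ (κ * c₁.re) * Real.exp (2 * ‖c₂‖) := by
  have ht0 : 0 < t := by linarith
  rw [Complex.norm_exp, Complex.re_ofReal_mul, re_ansatzExponent hc₀, Real.rpow_def_of_pos ht0,
    ← Real.exp_add]
  refine Real.exp_le_exp.2 ?_
  have h1 : |c₂.re / t| ≤ ‖c₂‖ := by
    rw [abs_div, abs_of_pos ht0]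
    exact (div_le_self (abs_nonneg _) ht).trans (Complex.abs_re_le_norm _)
  have h2 : |κ * (c₂.re / t)| ≤ 2 * ‖c₂‖ := by
    rw [abs_mul]
    gcongr
  nlinarith [neg_abs_le (κ * (c₂.re / t))]

variable {μ lam w : ℝ}

theorem exists_norm_ansatzResidual_le (h₀ : c₀ ^ 2 + w = 0)
    (h₁ : 2 * c₀ * c₁ + 2 * c₀ - 4 * μ * w = 0)
    (h₂ : c₁ ^ 2 + c₁ + 2 * c₀ * c₂ + lam + 8 * μ ^ 2 * w = 0) :
    ∃ A : ℝ, ∀ᶠ t : ℝ in atTop, ‖ansatzResidual c₀ c₁ c₂ μ lam w t‖ ≤ A / t ^ 3 := by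
  let S (u : ℝ) : ℂ := 2 * c₁ * c₂ + c₂ ^ 2 * u
    + 2 * μ ^ 2 / (1 - μ ^ 2 * u ^ 2) * (c₀ + c₁ * u + c₂ * u ^ 2)
    + lam * μ ^ 2 * u / (1 - μ ^ 2 * u ^ 2)
    + w * (-12 * μ ^ 3 - 8 * μ ^ 4 * u) / (1 + μ * u) ^ 2
  have hS : ContinuousAt S 0 := by
    have h1 : (1 - (μ : ℂ) ^ 2 * ((0 : ℝ) : ℂ) ^ 2) ≠ 0 := by simp
    have h2 : (1 + (μ : ℂ) * ((0 : ℝ) : ℂ)) ^ 2 ≠ 0 := by simp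
    fun_prop (disch := assumption)
  have hlim : Tendsto (fun t : ℝ => ‖S t⁻¹‖) atTop (𝓝 ‖S 0‖) :=
    (hS.tendsto.comp tendsto_inv_atTop_zero).norm
  refine ⟨‖S 0‖ + 1, ?_⟩
  filter_upwards [hlim.eventually_le_const (lt_add_one _), eventually_gt_atTop |μ|] with t hSt ht
  have ht0 : 0 < t := (abs_nonneg μ).trans_lt ht
  have hm : t - μ ≠ 0 := by linarith [le_abs_self μ]
  have hp : t + μ ≠ 0 := by linarith [neg_abs_le μ]
  have ht' : (t : ℂ) ≠ 0 := by exact_mod_cast ht0.ne'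
  have hp' : (t : ℂ) + μ ≠ 0 := by exact_mod_cast hp
  have hm' : (t : ℂ) - μ ≠ 0 := by exact_mod_cast hm
  have hP' : (t : ℂ) ^ 2 - μ ^ 2 ≠ 0 := by rw [sq_sub_sq]; exact mul_ne_zero hp' hm'
  have key : (t : ℂ) ^ 3 * ansatzResidual c₀ c₁ c₂ μ lam w t = S t⁻¹ := by
    have e1 : 1 - (μ : ℂ) ^ 2 * (t : ℂ)⁻¹ ^ 2 = (t ^ 2 - μ ^ 2) / t ^ 2 := by field_simp
    have e2 : 1 + (μ : ℂ) * (t : ℂ)⁻¹ = (t + μ) / t := by field_simp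
    simp only [S, ansatzResidual, ansatzSlope, Complex.ofReal_inv]
    rw [e1, e2]
    have : (t : ℂ) ^ 3 * ((-c₁ / t ^ 2 - 2 * c₂ / t ^ 3) + (c₀ + c₁ / t + c₂ / t ^ 2) ^ 2 +
        2 * t / (t ^ 2 - μ ^ 2) * (c₀ + c₁ / t + c₂ / t ^ 2) +
        (lam / (t ^ 2 - μ ^ 2) + w * ((t - μ) / (t + μ)) ^ 2)) -
      (2 * c₁ * c₂ + c₂ ^ 2 * (t : ℂ)⁻¹ +
        2 * μ ^ 2 / ((t ^ 2 - μ ^ 2) / t ^ 2) * (c₀ + c₁ * (t : ℂ)⁻¹ + c₂ * (t : ℂ)⁻¹ ^ 2) +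
        lam * μ ^ 2 * (t : ℂ)⁻¹ / ((t ^ 2 - μ ^ 2) / t ^ 2) +
        w * (-12 * μ ^ 3 - 8 * μ ^ 4 * (t : ℂ)⁻¹) / ((t + μ) / t) ^ 2) =
      t ^ 3 * (c₀ ^ 2 + w) + t ^ 2 * (2 * c₀ * c₁ + 2 * c₀ - 4 * μ * w) +
        t * (c₁ ^ 2 + c₁ + 2 * c₀ * c₂ + lam + 8 * μ ^ 2 * w) := by
      field_simp
      ring
    rw [h₀, h₁, h₂] at this
    linear_combination this
  rw [le_div_iff₀ (by positivity)]
  calc _ = ‖(t : ℂ) ^ 3 * ansatzResidual c₀ c₁ c₂ μ lam w t‖ := by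
        rw [norm_mul, norm_pow, Complex.norm_real, Real.norm_of_nonneg ht0.le, mul_comm]
    _ ≤ _ := by rw [key]; exact hSt

/-- `ψ` is a twice differentiable solution on `(t₁, ∞)` of the mode equation with potential `Z`. -/
def IsModeSolution (μ : ℝ) (Z : ℝ → ℝ) (t₁ : ℝ) (ψ : ℝ → ℂ) : Prop :=
  (∀ t ∈ Ioi t₁, DifferentiableAt ℝ ψ t ∧ DifferentiableAt ℝ (deriv ψ) t) ∧
    ∀ t ∈ Ioi t₁, deriv (deriv ψ) t + ((2 * t / (t ^ 2 - μ ^ 2) : ℝ) : ℂ) * deriv ψ t +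
      (Z t : ℂ) * ψ t = 0

theorem exists_modeSolution_exp_asymptotics {Z : ℝ → ℝ}
    (hZ : ∀ t, Z t = lam / (t ^ 2 - μ ^ 2) + w * ((t - μ) / (t + μ)) ^ 2)
    (hc₀ : c₀.re = 0) (hc₁ : c₁.re < 0) (h₀ : c₀ ^ 2 + w = 0)
    (h₁ : 2 * c₀ * c₁ + 2 * c₀ - 4 * μ * w = 0)
    (h₂ : c₁ ^ 2 + c₁ + 2 * c₀ * c₂ + lam + 8 * μ ^ 2 * w = 0) (t₀ : ℝ) :
    ∃ t₁ ≥ t₀, ∃ ψ : ℝ → ℂ, IsModeSolution μ Z t₁ ψ ∧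
      Tendsto (fun t : ℝ => ψ t * Complex.exp (-(c₀ * t + c₁ * (Real.log t : ℝ)))) atTop
        (𝓝 1) := by
  obtain ⟨A, hA⟩ := exists_norm_ansatzResidual_le h₀ h₁ h₂
  obtain ⟨T, hT⟩ := eventually_atTop.1
    (hA.and ((eventually_ge_atTop (1 : ℝ)).and
      ((eventually_ge_atTop (2 * |μ|)).and (eventually_ge_atTop t₀))))
  have hT1 : 1 ≤ T := (hT T le_rfl).2.1
  have hTt₀ : t₀ ≤ T := (hT T le_rfl).2.2.2
  have hpos {t : ℝ} (ht : T ≤ t) : 0 < t := by linarith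
  have hA0 : 0 ≤ A := by
    have := (norm_nonneg _).trans (hT T le_rfl).1
    have hT3 : 0 < T ^ 3 := pow_pos (hpos le_rfl) 3
    by_contra! hneg
    linarith [div_neg_of_neg_of_pos hneg hT3]
  have hmul {t : ℝ} (ht : T ≤ t) : t ^ 2 / 2 ≤ t ^ 2 - μ ^ 2 := by
    have h1 := (hT t ht).2.2.1
    nlinarith [abs_nonneg μ, sq_abs μ]
  have hP {t : ℝ} (ht : T ≤ t) : 0 < t ^ 2 - μ ^ 2 :=
    (hmul ht).trans_lt' (by have := hpos ht; positivity)
  have hPc {t : ℝ} (ht : T ≤ t) : (t : ℂ) ^ 2 - μ ^ 2 ≠ 0 := by exact_mod_cast (hP ht).ne'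
  have hplus {t : ℝ} (ht : T ≤ t) : (t : ℂ) + μ ≠ 0 := by
    intro h
    apply hPc ht
    rw [sq_sub_sq, h, zero_mul]
  have htc {t : ℝ} (ht : T ≤ t) : (t : ℂ) ≠ 0 := by exact_mod_cast (hpos ht).ne'
  set g := ansatzExponent c₀ c₁ c₂ with hg
  set q := ansatzSlope c₀ c₁ c₂ with hq
  set R := ansatzResidual c₀ c₁ c₂ μ lam w with hR
  set M := Real.exp (2 * ‖c₂‖) with hM
  set r := c₁.re with hr
  have hgd {t : ℝ} (ht : T ≤ t) : HasDerivAt g (q t) t := hasDerivAt_ansatzExponent (hpos ht)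
  have hqd {t : ℝ} (ht : T ≤ t) := hasDerivAt_ansatzSlope (c₀ := c₀) (c₁ := c₁) (c₂ := c₂) (hpos ht)
  have hPd (t : ℝ) : HasDerivAt (fun x : ℝ => (x : ℂ) ^ 2 - μ ^ 2) (2 * t) t := by
    have hid : HasDerivAt (fun x : ℝ => (x : ℂ)) 1 t := (hasDerivAt_id t).ofReal_comp
    refine ((hid.pow 2).sub_const ((μ : ℂ) ^ 2)).congr_deriv ?_
    simp
  let V (t : ℝ) : ℂ := Complex.exp ((-2 : ℝ) * g t) / (t ^ 2 - μ ^ 2)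
  let F (t : ℝ) : ℂ := Complex.exp ((2 : ℝ) * g t) * (t ^ 2 - μ ^ 2) * R t
  have hVd {t : ℝ} (ht : T ≤ t) :
      HasDerivAt V (-(2 * q t + 2 * t / (t ^ 2 - μ ^ 2)) * V t) t := by
    refine ((((hgd ht).const_mul ((-2 : ℝ) : ℂ)).cexp).div (hPd t) (hPc ht)).congr_deriv ?_
    have := hPc ht
    simp only [V]
    push_cast
    field_simp
    ring
  have hVc : ContinuousOn V (Ioi T) := fun t ht =>
    (hVd (mem_Ioi.1 ht).le).continuousAt.continuousWithinAt
  have hRc : ContinuousOn R (Ioi T) := by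
    intro t ht
    have ht' := (mem_Ioi.1 ht).le
    have k1 := htc ht'
    have k2 := hPc ht'
    have k3 := hplus ht'
    have k4 : (t : ℂ) ^ 2 ≠ 0 := pow_ne_zero 2 k1
    have k5 : (t : ℂ) ^ 3 ≠ 0 := pow_ne_zero 3 k1
    refine ContinuousAt.continuousWithinAt ?_
    simp only [hR]
    unfold ansatzResidual ansatzSlope
    fun_prop (disch := assumption)
  have hFc : ContinuousOn F (Ioi T) := by
    have hgc : ContinuousOn g (Ioi T) := fun t ht =>
      (hgd (mem_Ioi.1 ht).le).continuousAt.continuousWithinAt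
    have hPcont : ContinuousOn (fun x : ℝ => (x : ℂ) ^ 2 - μ ^ 2) (Ioi T) := by fun_prop
    exact ((hgc.const_mul _).cexp.mul hPcont).mul hRc
  have hFle {t : ℝ} (ht : T ≤ t) : ‖F t‖ ≤ M * A * t ^ (2 * r - 1) := by
    have h1 := norm_exp_ansatzExponent_le (c₁ := c₁) (c₂ := c₂) hc₀ (hT1.trans ht) 2 (by norm_num)
    have h2 := (hT t ht).1
    have h3 : ‖(t : ℂ) ^ 2 - μ ^ 2‖ ≤ t ^ 2 := by
      have : ((t : ℂ) ^ 2 - μ ^ 2) = ((t ^ 2 - μ ^ 2 : ℝ) : ℂ) := by push_cast; rfl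
      rw [this, Complex.norm_real, Real.norm_of_nonneg (hP ht).le]
      linarith [sq_nonneg μ]
    have ht0 := hpos ht
    rw [Real.rpow_sub ht0, Real.rpow_one]
    calc ‖F t‖ = ‖Complex.exp ((2 : ℝ) * g t)‖ * ‖(t : ℂ) ^ 2 - μ ^ 2‖ * ‖R t‖ := by
          simp only [F, norm_mul]
      _ ≤ t ^ (2 * r) * M * t ^ 2 * (A / t ^ 3) := by gcongr
      _ = _ := by field_simp
  have hVle {t : ℝ} (ht : T ≤ t) : ‖V t‖ ≤ 2 * M * t ^ (-2 * r - 2) := by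
    have h1 := norm_exp_ansatzExponent_le (c₁ := c₁) (c₂ := c₂) hc₀ (hT1.trans ht) (-2)
      (by norm_num)
    have h3 : t ^ 2 / 2 ≤ ‖(t : ℂ) ^ 2 - μ ^ 2‖ := by
      have : ((t : ℂ) ^ 2 - μ ^ 2) = ((t ^ 2 - μ ^ 2 : ℝ) : ℂ) := by push_cast; rfl
      rw [this, Complex.norm_real, Real.norm_of_nonneg (hP ht).le]
      exact hmul ht
    have ht0 := hpos ht
    rw [Real.rpow_sub ht0, Real.rpow_two]
    calc ‖V t‖ = ‖Complex.exp ((-2 : ℝ) * g t)‖ / ‖(t : ℂ) ^ 2 - μ ^ 2‖ := by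
          simp only [V, norm_div]
      _ ≤ t ^ (-2 * r) * M / (t ^ 2 / 2) := by gcongr
      _ = _ := by field_simp
  have hexp : 2 * r - 1 < -1 := by linarith
  have hFint : IntegrableOn F (Ioi T) :=
    Integrable.mono' ((integrableOn_Ioi_rpow_of_lt hexp (hpos le_rfl)).const_mul (M * A))
      (hFc.aestronglyMeasurable measurableSet_Ioi)
      ((ae_restrict_iff' measurableSet_Ioi).2
        (Eventually.of_forall fun t ht => hFle (le_of_lt ht)))
  have hVF : ∀ x > T, ‖V x‖ * ∫ y in Ioi x, ‖F y‖
      ≤ (2 * M * (M * A) / (-(2 * r))) * x ^ (-2 : ℝ) := by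
    intro x hx
    have hx0 := hpos (le_of_lt hx)
    have h1 : ∫ y in Ioi x, ‖F y‖ ≤ M * A * (x ^ (2 * r) / (-(2 * r))) := by
      calc _ ≤ ∫ y in Ioi x, M * A * y ^ (2 * r - 1) :=
            setIntegral_mono_on (hFint.mono_set (Ioi_subset_Ioi hx.le)).norm
              ((integrableOn_Ioi_rpow_of_lt hexp hx0).const_mul _) measurableSet_Ioi
              fun y hy => hFle (hx.le.trans (le_of_lt hy))
        _ = _ := by
            rw [integral_const_mul, integral_Ioi_rpow_of_lt hexp hx0, sub_add_cancel, div_neg,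
              neg_div]
    calc _ ≤ 2 * M * x ^ (-2 * r - 2) * (M * A * (x ^ (2 * r) / (-(2 * r)))) := by
          gcongr
          exact hVle hx.le
      _ = 2 * M * (M * A) / (-(2 * r)) * (x ^ (-2 * r - 2) * x ^ (2 * r)) := by ring
      _ = _ := by rw [← Real.rpow_add hx0]; congr 2; ring
  obtain ⟨T₁, hTT₁, h, G, hlim, hsol⟩ :=
    exists_perturbed_constant_solution (hpos le_rfl) hFint hFc hVc hVF
  have hψ {t : ℝ} (ht : T₁ < t) : HasDerivAt (fun t => Complex.exp (g t) * h t)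
      (Complex.exp (g t) * (q t * h t + V t * G t)) t := by
    refine ((hgd (hTT₁.trans ht.le)).cexp.mul (hsol t ht).1).congr_deriv ?_
    ring
  have hψ' {t : ℝ} (ht : T₁ < t) : HasDerivAt (deriv fun t => Complex.exp (g t) * h t)
      (-(2 * t / (t ^ 2 - μ ^ 2)) * (Complex.exp (g t) * (q t * h t + V t * G t))
        - (lam / (t ^ 2 - μ ^ 2) + w * ((t - μ) / (t + μ)) ^ 2) * (Complex.exp (g t) * h t)) t := by
    have ht' := hTT₁.trans ht.le
    have hd := (hgd ht').cexp.mul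
      (((hqd ht').mul (hsol t ht).1).add ((hVd ht').mul (hsol t ht).2))
    refine (hd.congr_of_eventuallyEq ?_).congr_deriv ?_
    · filter_upwards [Ioi_mem_nhds ht] with u hu
      exact (hψ hu).deriv
    · have hVFR : V t * F t = R t := by
        have hexp : Complex.exp ((-2 : ℝ) * g t) * Complex.exp ((2 : ℝ) * g t) = 1 := by
          rw [← Complex.exp_add]
          push_cast
          rw [neg_mul, neg_add_cancel, Complex.exp_zero]
        simp only [V, F]
        rw [div_mul_eq_mul_div, div_eq_iff (hPc ht')]
        linear_combination R t * (t ^ 2 - μ ^ 2) * hexp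
      have hRdef : R t = (-c₁ / t ^ 2 - 2 * c₂ / t ^ 3) + q t ^ 2 +
          2 * t / (t ^ 2 - μ ^ 2) * q t +
          (lam / (t ^ 2 - μ ^ 2) + w * ((t - μ) / (t + μ)) ^ 2) := rfl
      simp only [Pi.add_apply, Pi.mul_apply]
      linear_combination (-Complex.exp (g t) * h t) * (hVFR.trans hRdef)
  refine ⟨T₁, hTt₀.trans hTT₁, fun t => Complex.exp (g t) * h t, ⟨fun t ht =>
    ⟨(hψ ht).differentiableAt, (hψ' ht).differentiableAt⟩, fun t ht => ?_⟩, ?_⟩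
  · rw [(hψ' ht).deriv, (hψ ht).deriv, hZ]
    push_cast
    ring
  · have h0 : Tendsto (fun t : ℝ => -c₂ / (t : ℂ)) atTop (𝓝 0) := by
      have := (Complex.continuous_ofReal.tendsto 0).comp tendsto_inv_atTop_zero
      simpa [div_eq_mul_inv, Function.comp_def] using this.const_mul (-c₂)
    have h1 := (Complex.continuous_exp.tendsto 0).comp h0
    rw [Complex.exp_zero] at h1
    refine ((h1.mul hlim).congr fun t => ?_).trans (by rw [one_mul])
    simp only [Function.comp_apply]
    rw [mul_right_comm, ← Complex.exp_add]
    congr 2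
    rw [hg, ansatzExponent]
    ring

end ExponentialAnsatz

/-- Future asymptotics of scalar-field modes on the LRS vacuum Bianchi III solution: for
the mode equation `ψ'' + (2t/(t²−μ²))ψ' + (λ²/(t²−μ²) + (m/(2l))²((t−μ)/(t+μ))²)ψ = 0`
the fundamental solutions are `t⁻¹ e^{±i|m/(2l)|(t − 2μ log t)}(1+o(1))` for `m ≠ 0`,
`t^{-1/2} e^{±i|s| log t}(1+o(1))` for `m = 0`, `λ² > 1/4`, and `t^{-1/2 ± |s|}(1+o(1))`
for `m = 0`, `0 ≤ λ² < 1/4`, where `|s| = √|λ² − 1/4|` — the same asymptotic forms as for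
the LRS Bianchi VIII model with `Λ` in place of `λ²`. -/
theorem bianchiIII_mode_asymptotics (l μ : ℝ) (hl : 0 < l) (m : ℤ) (lamsq : ℝ)
    (hlamsq : 0 ≤ lamsq) (t₀ : ℝ) (ht₀ : |μ| < t₀)
    (Z : ℝ → ℝ)
    (hZ : ∀ t, Z t = lamsq / (t ^ 2 - μ ^ 2) +
      ((m : ℝ) / (2 * l)) ^ 2 * ((t - μ) / (t + μ)) ^ 2)
    (s : ℝ) (hs : s = Real.sqrt |lamsq - 1 / 4|)
    (ε : ℝ) (hε : ε = 1 ∨ ε = -1) :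
    (m ≠ 0 →
      ∃ t₁ ≥ t₀, ∃ ψ : ℝ → ℂ,
        (∀ t ∈ Ioi t₁, DifferentiableAt ℝ ψ t ∧ DifferentiableAt ℝ (deriv ψ) t) ∧
        (∀ t ∈ Ioi t₁,
          deriv (deriv ψ) t + ((2 * t / (t ^ 2 - μ ^ 2) : ℝ) : ℂ) * deriv ψ t +
            (Z t : ℂ) * ψ t = 0) ∧
        Tendsto (fun t : ℝ => ψ t * (t : ℂ) *
            Complex.exp (-(ε : ℂ) * Complex.I * ((|(m : ℝ)| / (2 * l) : ℝ) : ℂ) *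
              ((t : ℂ) - 2 * (μ : ℂ) * ((Real.log t : ℝ) : ℂ))))
          atTop (nhds 1)) ∧
    (m = 0 → lamsq > 1 / 4 →
      ∃ t₁ ≥ t₀, ∃ ψ : ℝ → ℂ,
        (∀ t ∈ Ioi t₁, DifferentiableAt ℝ ψ t ∧ DifferentiableAt ℝ (deriv ψ) t) ∧
        (∀ t ∈ Ioi t₁,
          deriv (deriv ψ) t + ((2 * t / (t ^ 2 - μ ^ 2) : ℝ) : ℂ) * deriv ψ t +
            (Z t : ℂ) * ψ t = 0) ∧
        Tendsto (fun t : ℝ => ψ t * ((t ^ ((1 : ℝ) / 2) : ℝ) : ℂ) *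
            Complex.exp (-(ε : ℂ) * Complex.I * (s : ℂ) * ((Real.log t : ℝ) : ℂ)))
          atTop (nhds 1)) ∧
    (m = 0 → lamsq < 1 / 4 →
      ∃ t₁ ≥ t₀, ∃ ψ : ℝ → ℂ,
        (∀ t ∈ Ioi t₁, DifferentiableAt ℝ ψ t ∧ DifferentiableAt ℝ (deriv ψ) t) ∧
        (∀ t ∈ Ioi t₁,
          deriv (deriv ψ) t + ((2 * t / (t ^ 2 - μ ^ 2) : ℝ) : ℂ) * deriv ψ t +
            (Z t : ℂ) * ψ t = 0) ∧
        Tendsto (fun t : ℝ => ψ t * ((t ^ ((1 : ℝ) / 2 - ε * s) : ℝ) : ℂ))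
          atTop (nhds 1)) := by
  refine ⟨fun hm => ?_, fun hm hlam => ?_, fun hm hlam => ?_⟩
  · have hεsq : (ε : ℂ) ^ 2 = 1 := by rcases hε with rfl | rfl <;> norm_num
    have hε0 : (ε : ℂ) ≠ 0 := by rintro h; simp [h] at hεsq
    set ω : ℝ := |(m : ℝ)| / (2 * l) with hω
    have hω0 : (ω : ℂ) ≠ 0 := by
      have : ω ≠ 0 := by positivity
      exact_mod_cast this
    have hωsq : ((m : ℝ) / (2 * l)) ^ 2 = ω ^ 2 := by rw [hω, div_pow, div_pow, sq_abs]
    rw [hωsq] at hZ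
    have hI : Complex.I ^ 2 = -1 := Complex.I_sq
    set c₀ : ℂ := ε * Complex.I * ω with hc₀
    have hc₀0 : c₀ ≠ 0 := by simp [hc₀, hε0, hω0]
    have hc₀sq : c₀ ^ 2 = -ω ^ 2 := by
      rw [hc₀, mul_pow, mul_pow, hεsq, hI]; ring
    set c₁ : ℂ := -1 - 2 * μ * c₀ with hc₁
    obtain ⟨t₁, ht₁, ψ, hψ, hlim⟩ := exists_modeSolution_exp_asymptotics (c₀ := c₀) (c₁ := c₁)
      (c₂ := -(c₁ ^ 2 + c₁ + lamsq + 8 * μ ^ 2 * ω ^ 2) / (2 * c₀)) (w := ω ^ 2) hZ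
      (by simp [hc₀]) (by simp [hc₁, hc₀]) (by rw [hc₀sq]; push_cast; ring)
      (by rw [hc₁]; push_cast; linear_combination (-4 * (μ : ℂ)) * hc₀sq)
      (by push_cast; field_simp; ring) t₀
    refine ⟨t₁, ht₁, ψ, hψ.1, hψ.2, hlim.congr' ?_⟩
    filter_upwards [eventually_gt_atTop 0] with t ht
    have hlog : (t : ℂ) = Complex.exp (Real.log t : ℝ) := by
      rw [← Complex.ofReal_exp, Real.exp_log ht]
    rw [show ψ t * (t : ℂ) = ψ t * Complex.exp (Real.log t : ℝ) by rw [← hlog],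
      mul_assoc (ψ t), ← Complex.exp_add]
    congr 2
    rw [hc₁, hc₀]
    ring
  · have hs2 : (s : ℂ) ^ 2 = lamsq - 1 / 4 := by
      have : s ^ 2 = lamsq - 1 / 4 := by
        rw [hs, Real.sq_sqrt (abs_nonneg _), abs_of_pos (by linarith)]
      simpa using congrArg ((↑) : ℝ → ℂ) this
    have hεsq : (ε : ℂ) ^ 2 = 1 := by rcases hε with rfl | rfl <;> norm_num
    obtain ⟨t₁, ht₁, ψ, hψ, hlim⟩ := exists_modeSolution_exp_asymptotics (c₀ := 0)
      (c₁ := -(1 / 2) + ε * Complex.I * s) (c₂ := 0) (w := 0) (lam := lamsq) (μ := μ) (Z := Z)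
      (fun t => by rw [hZ t, hm]; simp) (by simp) (by simp) (by simp) (by simp)
      (by
        push_cast
        linear_combination ((s : ℂ) ^ 2 * Complex.I ^ 2) * hεsq + (s : ℂ) ^ 2 * Complex.I_sq - hs2)
      t₀
    refine ⟨t₁, ht₁, ψ, hψ.1, hψ.2, hlim.congr' ?_⟩
    filter_upwards [eventually_gt_atTop 0] with t ht
    rw [Real.rpow_def_of_pos ht, Complex.ofReal_exp, mul_assoc (ψ t), ← Complex.exp_add]
    congr 2
    push_cast
    ring
  · have hs2 : s ^ 2 = 1 / 4 - lamsq := by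
      rw [hs, Real.sq_sqrt (abs_nonneg _), abs_of_neg (by linarith)]; ring
    have hs0 : 0 ≤ s := hs ▸ Real.sqrt_nonneg _
    have hεsq : ε ^ 2 = 1 := by rcases hε with rfl | rfl <;> norm_num
    by_cases hneg : ε * s < 1 / 2
    · obtain ⟨t₁, ht₁, ψ, hψ, hlim⟩ := exists_modeSolution_exp_asymptotics (c₀ := 0)
        (c₁ := ((-(1 / 2) + ε * s : ℝ) : ℂ)) (c₂ := 0) (w := 0) (lam := lamsq) (μ := μ) (Z := Z)
        (fun t => by rw [hZ t, hm]; simp) (by simp) (by rw [Complex.ofReal_re]; linarith)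
        (by simp) (by simp)
        (by
          have : (-(1 / 2) + ε * s) ^ 2 + (-(1 / 2) + ε * s) + lamsq = 0 := by
            linear_combination s ^ 2 * hεsq + hs2
          simpa using congrArg ((↑) : ℝ → ℂ) this)
        t₀
      refine ⟨t₁, ht₁, ψ, hψ.1, hψ.2, hlim.congr' ?_⟩
      filter_upwards [eventually_gt_atTop 0] with t ht
      rw [Real.rpow_def_of_pos ht, Complex.ofReal_exp]
      congr 2
      push_cast
      ring
    · have hεs : ε * s = 1 / 2 := by
        rcases hε with rfl | rfl <;> nlinarith
      have hl0 : lamsq = 0 := by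
        linear_combination hs2 + s ^ 2 * hεsq - (ε * s + 1 / 2) * hεs
      refine ⟨t₀, le_rfl, fun _ => 1, fun t _ => ⟨by simp, by simp⟩, fun t _ => ?_, ?_⟩
      · simp [hZ, hl0, hm]
      · simp [hεs]
end
end
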